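/- arXiv:2002.11856 — 4 statements merged into one kernel-verified Lean document; each statement's English description precedes it below -/
import Mathlib

section
/- Cartan's uniqueness theorem: if H is a holomorphic map from the open unit ball B ⊂ ℂⁿ into itself with H(0) = 0 and DH(0) = I, then H(z) = z for all z ∈ B. -/
theorem cartan_uniqueness {n : ℕ}
    (H : EuclideanSpace ℂ (Fin n) → EuclideanSpace ℂ (Fin n))
    (hhol : DifferentiableOn ℂ H (Metric.ball 0 1))
    (hmaps : Set.MapsTo H (Metric.ball 0 1) (Metric.ball 0 1))
    (h0 : H 0 = 0)
    (hD : fderiv ℂ H 0 = ContinuousLinearMap.id ℂ (EuclideanSpace ℂ (Fin n))) :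
    ∀ z ∈ Metric.ball (0 : EuclideanSpace ℂ (Fin n)) 1, H z = z := by
  intro z hz
  rcases eq_or_ne z 0 with rfl | hne
  · exact h0
  have hzn : ‖z‖ ≠ 0 := norm_ne_zero_iff.mpr hne
  have hznC : (‖z‖ : ℂ) ≠ 0 := by exact_mod_cast hzn
  -- restrict to the complex line through `z`
  set u : EuclideanSpace ℂ (Fin n) := (‖z‖ : ℂ)⁻¹ • z with hu
  have hun : ‖u‖ = 1 := by
    rw [hu, norm_smul, norm_inv, Complex.norm_real, norm_norm, inv_mul_cancel₀ hzn]
  have hzu : (‖z‖ : ℂ) • u = z := by rw [hu, smul_inv_smul₀ hznC]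
  have hline : Set.MapsTo (fun t : ℂ => t • u) (Metric.ball 0 1) (Metric.ball 0 1) := by
    intro t ht
    simpa [norm_smul, hun] using ht
  have hd : DifferentiableOn ℂ (fun t : ℂ => H (t • u)) (Metric.ball 0 1) :=
    hhol.comp (by fun_prop) hline
  have hm : Set.MapsTo (fun t : ℂ => H (t • u)) (Metric.ball 0 1)
      (Metric.closedBall ((fun t : ℂ => H (t • u)) 0) 1) := by
    intro t ht
    have := Metric.ball_subset_closedBall (hmaps (hline ht))
    simpa [h0] using this
  have hH : HasFDerivAt H (ContinuousLinearMap.id ℂ (EuclideanSpace ℂ (Fin n))) ((0 : ℂ) • u) := by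
    rw [zero_smul, ← hD]
    exact (hhol.differentiableAt (Metric.ball_mem_nhds _ one_pos)).hasFDerivAt
  have hderiv : HasDerivAt (fun t : ℂ => H (t • u)) u 0 := by
    have h1 : HasDerivAt (fun t : ℂ => t • u) u 0 := by
      simpa using (hasDerivAt_id (0 : ℂ)).smul_const u
    exact hH.comp_hasDerivAt (0 : ℂ) h1
  have hds : dslope (fun t : ℂ => H (t • u)) 0 0 = u := by
    rw [dslope_same, hderiv.deriv]
  have key := Complex.affine_of_mapsTo_ball_of_norm_dslope_eq_div hd hm
    (Metric.mem_ball_self one_pos) (by rw [hds, hun, div_one])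
  have hzmem : (‖z‖ : ℂ) ∈ Metric.ball (0 : ℂ) 1 := by simpa using hz
  have h2 := key hzmem
  rw [hds] at h2
  simp only [zero_smul, h0, zero_add, sub_zero, hzu] at h2
  exact h2
end

section
/- Let F, G : ℂⁿ → ℂⁿ (n ≥ 2) be biholomorphic automorphisms of ℂⁿ normalized by F(0) = G(0) = 0 and DF(0) = DG(0) = I. If the function log(‖F(z)‖/‖G(z)‖) is pluriharmonic on ℂⁿ \ {0}, then F = G. -/
noncomputable def levi {n : ℕ} (g : EuclideanSpace ℂ (Fin n) → ℝ)
    (z v w : EuclideanSpace ℂ (Fin n)) : ℂ :=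
  (1/4 : ℂ) * ((((iteratedFDeriv ℝ 2 g z ![v, w]
      + iteratedFDeriv ℝ 2 g z ![Complex.I • v, Complex.I • w] : ℝ)) : ℂ)
    + Complex.I * (((iteratedFDeriv ℝ 2 g z ![Complex.I • v, w]
      - iteratedFDeriv ℝ 2 g z ![v, Complex.I • w] : ℝ)) : ℂ))

open Filter Topology MeasureTheory Set


section smooth
variable {E : Type*} [NormedAddCommGroup E] [NormedSpace ℂ E] [FiniteDimensional ℂ E]

lemma fderiv_apply_eq_circle (F : E → E) (hF : Differentiable ℂ F) (x y : E) :
    fderiv ℂ F x y = (2 * (Real.pi : ℂ) * Complex.I)⁻¹ •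
      ∫ θ in Set.Ioc 0 (2 * Real.pi), (deriv (circleMap 0 1) θ * ((circleMap 0 1 θ) ^ 2)⁻¹) •
        F (x + circleMap 0 1 θ • y) := by
  have : CompleteSpace E := FiniteDimensional.complete ℂ E
  have hline : Differentiable ℂ (fun t : ℂ => F (x + t • y)) := by fun_prop
  have h := Complex.two_pi_I_inv_smul_circleIntegral_sub_sq_inv_smul_of_differentiable
    (isOpen_univ) (c := 0) (w₀ := 0) (R := 1) (subset_univ _) hline.differentiableOn (by simp)
  have hd : deriv (fun t : ℂ => F (x + t • y)) 0 = fderiv ℂ F x y := by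
    have h1 : HasDerivAt (fun t : ℂ => x + t • y) y 0 := by
      simpa using ((hasDerivAt_id (0:ℂ)).smul_const y).const_add x
    have h2 : HasFDerivAt F (fderiv ℂ F x) (x + (0:ℂ) • y) := by
      simpa using (hF x).hasFDerivAt
    exact (h2.comp_hasDerivAt (0:ℂ) h1).deriv
  rw [hd] at h
  rw [← h, circleIntegral, intervalIntegral.integral_of_le (by positivity)]
  simp [smul_smul]

lemma differentiable_fderiv_apply (F : E → E) (hF : Differentiable ℂ F) (y : E) :
    Differentiable ℂ (fun x => fderiv ℂ F x y) := by
  have : CompleteSpace E := FiniteDimensional.complete ℂ E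
  have : ProperSpace E := FiniteDimensional.proper ℂ E
  let : MeasurableSpace E := borel E
  have : BorelSpace E := ⟨rfl⟩
  have heq := funext (fun x => fderiv_apply_eq_circle F hF x y)
  rw [heq]
  intro x₀
  apply DifferentiableAt.const_smul
  set κ : ℝ → ℂ := fun θ => deriv (circleMap 0 1) θ * ((circleMap 0 1 θ) ^ 2)⁻¹ with hκ
  have hne : ∀ θ, circleMap 0 1 θ ≠ 0 := fun θ => circleMap_ne_center one_ne_zero
  have hκc : Continuous κ := by
    have : κ = fun θ => (circleMap 0 1 θ * Complex.I) * ((circleMap 0 1 θ) ^ 2)⁻¹ := by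
      funext θ; simp [hκ]
    rw [this]
    have hc := continuous_circleMap 0 1
    exact (hc.mul continuous_const).mul ((hc.pow 2).inv₀ (fun θ => pow_ne_zero _ (hne θ)))
  have hκn : ∀ θ, ‖κ θ‖ = 1 := by intro θ; simp [hκ]
  have hc := continuous_circleMap 0 1
  have hFc := hF.continuous
  -- bound
  obtain ⟨M, hM⟩ := (isCompact_closedBall x₀ (2 + ‖y‖)).exists_bound_of_continuousOn
    hFc.continuousOn
  have hDF : ∀ x ∈ Metric.ball x₀ (1 + ‖y‖), ‖fderiv ℂ F x‖ ≤ 2 * M := by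
    intro x hx
    rw [Metric.mem_ball] at hx
    have h := Complex.norm_fderiv_le_div_of_mapsTo_ball (R₁ := 1) (R₂ := 2 * M) (c := x)
      hF.differentiableOn ?_ one_pos
    · simpa using h
    · intro u hu
      rw [Metric.mem_ball] at hu
      have h1 := hM u (by
        rw [Metric.mem_closedBall]; linarith [dist_triangle u x x₀])
      have h2 := hM x (by
        rw [Metric.mem_closedBall]; linarith)
      rw [Metric.mem_closedBall, dist_eq_norm]
      linarith [norm_sub_le (F u) (F x)]
  have key := hasFDerivAt_integral_of_dominated_loc_of_lip' (𝕜 := ℂ)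
    (μ := volume.restrict (Set.Ioc 0 (2 * Real.pi))) (x₀ := x₀)
    (s := Metric.ball x₀ 1)
    (F := fun x θ => κ θ • F (x + circleMap 0 1 θ • y))
    (F' := fun θ => κ θ • fderiv ℂ F (x₀ + circleMap 0 1 θ • y))
    (bound := fun _ => 2 * M)
    (Metric.ball_mem_nhds _ one_pos) ?_ ?_ ?_ ?_ ?_ ?_
  · exact key.2.differentiableAt
  · intro x hx
    have : Continuous (fun θ => κ θ • F (x + circleMap 0 1 θ • y)) := by fun_prop
    exact this.aestronglyMeasurable
  · have : Continuous (fun θ => κ θ • F (x₀ + circleMap 0 1 θ • y)) := by fun_prop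
    exact (this.integrableOn_Ioc)
  · have h1 : Measurable (fun θ : ℝ => fderiv ℂ F (x₀ + circleMap 0 1 θ • y)) :=
      (measurable_fderiv ℂ F).comp (by fun_prop : Continuous
        (fun θ : ℝ => x₀ + circleMap 0 1 θ • y)).measurable
    have : FiniteDimensional ℂ (E →L[ℂ] E) := inferInstance
    have : ProperSpace (E →L[ℂ] E) := FiniteDimensional.proper ℂ _
    exact hκc.aestronglyMeasurable.smul h1.aestronglyMeasurable
  · refine Eventually.of_forall fun θ x hx => ?_
    rw [← smul_sub, norm_smul, hκn, one_mul]
    have hb : ∀ u ∈ Metric.ball x₀ 1, u + circleMap 0 1 θ • y ∈ Metric.ball x₀ (1 + ‖y‖) := by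
      intro u hu
      rw [Metric.mem_ball, dist_eq_norm] at hu ⊢
      have : u + circleMap 0 1 θ • y - x₀ = (u - x₀) + circleMap 0 1 θ • y := by abel
      rw [this]
      have h3 : ‖circleMap 0 1 θ • y‖ = ‖y‖ := by simp [norm_smul]
      linarith [norm_add_le (u - x₀) (circleMap 0 1 θ • y)]
    have := (convex_ball x₀ (1 + ‖y‖)).norm_image_sub_le_of_norm_fderiv_le (𝕜 := ℂ) (f := F)
      (fun u _ => hF u) hDF (hb x₀ (Metric.mem_ball_self one_pos)) (hb x hx)
    rw [add_sub_add_right_eq_sub] at this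
    exact this
  · exact integrable_const _
  · refine Eventually.of_forall fun θ => ?_
    have h1 : HasFDerivAt (fun x => x + circleMap 0 1 θ • y) (ContinuousLinearMap.id ℂ E) x₀ :=
      (hasFDerivAt_id x₀).add_const _
    have h2 := ((hF (x₀ + circleMap 0 1 θ • y)).hasFDerivAt).comp x₀ h1
    exact h2.const_smul (κ θ)

lemma contDiff_two (F : E → E) (hF : Differentiable ℂ F) : ContDiff ℂ 2 F := by
  have h : ∀ n : ℕ, ∀ F : E → E, Differentiable ℂ F → ContDiff ℂ n F := by
    intro n
    induction n with
    | zero => intro F hF; exact contDiff_zero.2 hF.continuous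
    | succ k ih =>
      intro F hF
      push_cast
      rw [contDiff_succ_iff_fderiv_apply]
      exact ⟨hF, by simp, fun y => ih _ (differentiable_fderiv_apply F hF y)⟩
  exact_mod_cast h 2 F hF
end smooth


lemma iterated_two_of_line {E : Type*} [NormedAddCommGroup E] [NormedSpace ℝ E]
    (g : E → ℝ) (z v : E) (hg : ContDiffAt ℝ 2 g z) (p : ℝ → ℝ) (q : ℝ)
    (hp : ∀ᶠ s in 𝓝 (0:ℝ), HasDerivAt (fun s : ℝ => g (z + s • v)) (p s) s)
    (hq : HasDerivAt p q 0) : iteratedFDeriv ℝ 2 g z ![v, v] = q := by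
  rw [iteratedFDeriv_two_apply]
  simp only [Matrix.cons_val_zero, Matrix.cons_val_one]
  have hl : ∀ s : ℝ, HasDerivAt (fun s : ℝ => z + s • v) v s := fun s => by
    simpa using ((hasDerivAt_id s).smul_const v).const_add z
  have hd : DifferentiableAt ℝ (fderiv ℝ g) z :=
    (hg.fderiv_right (m := 1) (by norm_num)).differentiableAt (by norm_num)
  have h1 : HasDerivAt (fun s : ℝ => fderiv ℝ g (z + s • v) v) (fderiv ℝ (fderiv ℝ g) z v v) 0 := by
    have h2 : HasFDerivAt (fderiv ℝ g) (fderiv ℝ (fderiv ℝ g) z) (z + (0:ℝ) • v) := by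
      simpa using hd.hasFDerivAt
    have h3 := h2.comp_hasDerivAt (0:ℝ) (hl 0)
    simpa using h3.clm_apply (hasDerivAt_const (0:ℝ) v)
  have hev : ∀ᶠ x in 𝓝 z, DifferentiableAt ℝ g x := by
    filter_upwards [hg.eventually (by simp)] with x hx using hx.differentiableAt (by norm_num)
  have hc : Tendsto (fun s : ℝ => z + s • v) (𝓝 0) (𝓝 z) := by
    simpa using (hl 0).continuousAt.tendsto
  have h4 : p =ᶠ[𝓝 0] (fun s : ℝ => fderiv ℝ g (z + s • v) v) := by
    filter_upwards [hp, hc.eventually hev] with s hs hs2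
    exact hs.unique (hs2.hasFDerivAt.comp_hasDerivAt s (hl s))
  exact h1.unique (hq.congr_of_eventuallyEq h4.symm)

section
variable {E : Type*} [NormedAddCommGroup E] [InnerProductSpace ℂ E]

lemma hasDerivAt_norm_sq' (γ : ℝ → E) (γ1 : E) (s : ℝ) (h : HasDerivAt γ γ1 s) :
    HasDerivAt (fun s => ‖γ s‖ ^ 2) (2 * (inner ℂ (γ s) γ1).re) s := by
  let := InnerProductSpace.rclikeToReal ℂ E
  exact HasDerivAt.norm_sq h

lemma log_norm_deriv (γ : ℝ → E) (γ1 : E) (s : ℝ) (h : HasDerivAt γ γ1 s) (h0 : γ s ≠ 0) :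
    HasDerivAt (fun s => Real.log ‖γ s‖) ((inner ℂ (γ s) γ1).re / ‖γ s‖ ^ 2) s := by
  have hn : ‖γ s‖ ^ 2 ≠ 0 := by simpa using h0
  have h1 := ((hasDerivAt_norm_sq' γ γ1 s h).log hn).div_const 2
  have h2 : (fun s => Real.log ‖γ s‖) = fun s => Real.log (‖γ s‖ ^ 2) / 2 := by
    funext s; rw [Real.log_pow]; push_cast; ring
  rw [h2]
  refine h1.congr_deriv ?_
  field_simp

lemma log_norm_deriv2 (γ γ1 : ℝ → E) (γ2 : E) (s : ℝ) (h : HasDerivAt γ (γ1 s) s)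
    (h2 : HasDerivAt γ1 γ2 s) (h0 : γ s ≠ 0) :
    HasDerivAt (fun s => (inner ℂ (γ s) (γ1 s)).re / ‖γ s‖ ^ 2)
      ((‖γ1 s‖ ^ 2 + (inner ℂ (γ s) γ2).re) / ‖γ s‖ ^ 2
        - 2 * (inner ℂ (γ s) (γ1 s)).re ^ 2 / ‖γ s‖ ^ 4) s := by
  have hn : ‖γ s‖ ≠ 0 := by simpa using h0
  have hi := HasDerivAt.inner ℂ h h2
  have hre : HasDerivAt (fun s => (inner ℂ (γ s) (γ1 s)).re)
      (inner ℂ (γ s) γ2 + inner ℂ (γ1 s) (γ1 s)).re s :=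
    (Complex.reCLM.hasFDerivAt).comp_hasDerivAt s hi
  have := hre.div (hasDerivAt_norm_sq' γ _ s h) (pow_ne_zero 2 hn)
  refine this.congr_deriv ?_
  have : (inner ℂ (γ1 s) (γ1 s)).re = ‖γ1 s‖ ^ 2 := by
    exact inner_self_eq_norm_sq (𝕜 := ℂ) (γ1 s)
  rw [Complex.add_re, this]
  field_simp
  ring

/-- data for one direction -/
lemma dir_deriv (F : E → E) (z v : E) (f1 : ℂ → E) (f2 : E)
    (hf : ∀ t : ℂ, HasDerivAt (fun t : ℂ => F (z + t • v)) (f1 t) t)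
    (hf1 : HasDerivAt f1 f2 0) (h0 : F z ≠ 0) (c : ℂ) :
    ∃ p : ℝ → ℝ, (∀ᶠ s in 𝓝 (0:ℝ),
        HasDerivAt (fun s : ℝ => Real.log ‖F (z + s • (c • v))‖) (p s) s) ∧
      HasDerivAt p ((‖c • f1 0‖ ^ 2 + (inner ℂ (F z) (c • c • f2)).re) / ‖F z‖ ^ 2
        - 2 * (inner ℂ (F z) (c • f1 0)).re ^ 2 / ‖F z‖ ^ 4) 0 := by
  have hl : ∀ s : ℝ, HasDerivAt (fun s : ℝ => (s : ℂ) * c) c s := fun s => by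
    simpa using (Complex.ofRealCLM.hasDerivAt (x := s)).mul_const c
  have hγ : ∀ s : ℝ, HasDerivAt (fun s : ℝ => F (z + s • (c • v))) (c • f1 (s * c)) s := by
    intro s
    have := (hf (s * c)).scomp s (hl s)
    have h2 : (fun s : ℝ => F (z + s • (c • v))) = (fun t : ℂ => F (z + t • v)) ∘
      (fun s : ℝ => (s : ℂ) * c) := by
      funext s; simp [mul_smul]
    rw [h2]; exact this
  have hγ1 : HasDerivAt (fun s : ℝ => c • f1 (s * c)) (c • c • f2) 0 := by
    have h3 : HasDerivAt f1 f2 ((0:ℝ) * c) := by simpa using hf1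
    have := h3.scomp (0:ℝ) (hl 0)
    exact this.const_smul c
  refine ⟨fun s => (inner ℂ (F (z + s • (c • v))) (c • f1 (s * c))).re /
    ‖F (z + s • (c • v))‖ ^ 2, ?_, ?_⟩
  · have : ∀ᶠ s in 𝓝 (0:ℝ), F (z + s • (c • v)) ≠ 0 :=
      (hγ 0).continuousAt.eventually_ne (by simpa using h0)
    filter_upwards [this] with s hs
    exact log_norm_deriv _ _ s (hγ s) hs
  · have := log_norm_deriv2 (fun s : ℝ => F (z + s • (c • v))) (fun s : ℝ => c • f1 (s * c))
      (c • c • f2) 0 (hγ 0) hγ1 (by simpa using h0)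
    simpa using this

lemma sum_dirs (a b b2 : E) :
    ((‖(1:ℂ) • b‖ ^ 2 + (inner ℂ a ((1:ℂ) • (1:ℂ) • b2)).re) / ‖a‖ ^ 2
        - 2 * (inner ℂ a ((1:ℂ) • b)).re ^ 2 / ‖a‖ ^ 4) +
    ((‖Complex.I • b‖ ^ 2 + (inner ℂ a (Complex.I • Complex.I • b2)).re) / ‖a‖ ^ 2
        - 2 * (inner ℂ a (Complex.I • b)).re ^ 2 / ‖a‖ ^ 4) =
    2 * (‖b‖ ^ 2 / ‖a‖ ^ 2 - ‖inner ℂ a b‖ ^ 2 / ‖a‖ ^ 4) := by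
  have h1 : ‖inner ℂ a b‖ ^ 2 = (inner ℂ a b).re ^ 2 + (inner ℂ a b).im ^ 2 := by
    rw [Complex.sq_norm, Complex.normSq_apply]; ring
  rw [h1]
  simp only [one_smul, inner_smul_right, norm_smul, Complex.norm_I, one_mul, smul_smul,
    Complex.I_mul_I, neg_smul, inner_neg_right, Complex.neg_re, Complex.mul_re, Complex.I_re,
    Complex.I_im]
  ring
end


/-- a pair of mutually inverse entire functions fixing 0 with derivative one is the identity -/
lemma entire_aut_eq_id (p q : ℂ → ℂ) (hp : Differentiable ℂ p) (hq : Differentiable ℂ q)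
    (hpq : ∀ x, p (q x) = x) (hqp : ∀ x, q (p x) = x) (hp0 : p 0 = 0)
    (hd : deriv p 0 = 1) : ∀ x, p x = x := by
  have hq0 : q 0 = 0 := by rw [← hp0, hqp]; exact hp0.symm
  have aux : ∀ p q : ℂ → ℂ, Differentiable ℂ p → Differentiable ℂ q →
      (∀ x, p (q x) = x) → (∀ x, q (p x) = x) → p 0 = 0 →
      DifferentiableAt ℂ (fun ζ => (p ζ⁻¹)⁻¹) 0 := by
    intro p q hp hq hpq hqp hp0
    let e : ℂ ≃ₜ ℂ := ⟨⟨p, q, hqp, hpq⟩, hp.continuous, hq.continuous⟩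
    have hco : Tendsto p (Bornology.cobounded ℂ) (Bornology.cobounded ℂ) := by
      rw [Metric.cobounded_eq_cocompact]
      exact e.isClosedEmbedding.tendsto_cocompact
    have hne : ∀ x, x ≠ 0 → p x ≠ 0 := by
      intro x hx h
      apply hx
      rw [← hqp x, h]
      conv_lhs => rw [← hp0]
      exact hqp 0
    refine (Complex.analyticAt_of_differentiable_on_punctured_nhds_of_continuousAt
      ?_ ?_).differentiableAt
    · filter_upwards [self_mem_nhdsWithin] with z hz
      have hz' : z ≠ 0 := hz
      have h1 : DifferentiableAt ℂ (fun ζ : ℂ => ζ⁻¹) z := differentiableAt_inv hz'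
      exact ((hp z⁻¹).comp z h1).inv (hne _ (inv_ne_zero hz'))
    · rw [continuousAt_iff_punctured_nhds]
      have := (tendsto_inv₀_cobounded (α := ℂ)).comp
        (hco.comp (tendsto_inv₀_nhdsNE_zero (α := ℂ)))
      simpa [hp0, Function.comp_def] using this
  have hH := aux p q hp hq hpq hqp hp0
  have hK := aux q p hq hp hqp hpq hq0
  set H : ℂ → ℂ := fun ζ => (p ζ⁻¹)⁻¹ with hHdef
  set K : ℂ → ℂ := fun ζ => (q ζ⁻¹)⁻¹ with hKdef
  have hH0 : H 0 = 0 := by simp [hHdef, hp0]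
  have hKH : ∀ ζ, K (H ζ) = ζ := by intro ζ; simp [hHdef, hKdef, hqp]
  have hc : deriv H 0 ≠ 0 := by
    have h1 : HasDerivAt K (deriv K 0) (H 0) := by rw [hH0]; exact hK.hasDerivAt
    have h2 := h1.comp (0:ℂ) hH.hasDerivAt
    have h3 : K ∘ H = id := funext hKH
    rw [h3] at h2
    have h4 := h2.unique (hasDerivAt_id (0:ℂ))
    intro h; rw [h] at h4; simp at h4
  have hk : Differentiable ℂ (dslope p 0) := by
    rw [← differentiableOn_univ]
    exact (Complex.differentiableOn_dslope univ_mem).2 hp.differentiableOn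
  have hlim : Tendsto (dslope p 0) (cocompact ℂ) (𝓝 (deriv H 0)⁻¹) := by
    rw [← Metric.cobounded_eq_cocompact]
    have h1 := (hasDerivAt_iff_tendsto_slope.1 hH.hasDerivAt).comp
      (tendsto_inv₀_cobounded' (α := ℂ))
    have h2 := h1.inv₀ hc
    refine h2.congr' ?_
    have : ∀ᶠ x in Bornology.cobounded ℂ, x ≠ (0:ℂ) := by
      rw [Metric.cobounded_eq_cocompact]
      exact isCompact_singleton.compl_mem_cocompact
    filter_upwards [this] with x hx
    rw [dslope_of_ne _ hx]
    simp [slope_def_field, hHdef, hp0, div_eq_mul_inv, mul_comm]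
  have hconst := hk.eq_const_of_tendsto_cocompact hlim
  intro x
  by_cases hx : x = 0
  · rw [hx, hp0]
  have h1 : dslope p 0 x = dslope p 0 0 := by rw [hconst]; rfl
  rw [dslope_same, hd, dslope_of_ne _ hx, slope_def_field, hp0, sub_zero, sub_zero,
    div_eq_one_iff_eq hx] at h1
  exact h1

lemma curve_in_line {E : Type*} [NormedAddCommGroup E] [InnerProductSpace ℂ E] [CompleteSpace E]
    (g : ℂ → E) (w : E) (hw : w ≠ 0) (hg : Differentiable ℂ g) (h0 : g 0 = 0)
    (hd : deriv g 0 = w) (hpar : ∀ t, t ≠ 0 → ∃ c : ℂ, deriv g t = c • g t) :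
    ∀ t, g t = (inner ℂ w (g t) / (‖w‖ : ℂ) ^ 2) • w := by
  have hwn : (‖w‖ : ℂ) ≠ 0 := by simpa using hw
  set A : E →L[ℂ] ℂ := innerSL ℂ w with hA
  set L : E →L[ℂ] E := ContinuousLinearMap.id ℂ E -
    (((‖w‖ : ℂ) ^ 2)⁻¹ • A).smulRight w with hL
  have hLa : ∀ x, L x = x - (inner ℂ w x / (‖w‖ : ℂ) ^ 2) • w := by
    intro x; simp [hL, hA, div_eq_inv_mul]
  have hAw : A w = (‖w‖ : ℂ) ^ 2 := by simp [hA]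
  have hLw : L w = 0 := by
    rw [hLa]
    have : inner ℂ w w = (‖w‖ : ℂ) ^ 2 := by simp
    rw [this, div_self (pow_ne_zero 2 hwn)]; simp
  set a : ℂ → ℂ := fun t => A (g t) with ha
  set b : ℂ → E := fun t => L (g t) with hb
  have hda : ∀ t, HasDerivAt a (A (deriv g t)) t := fun t =>
    A.hasFDerivAt.comp_hasDerivAt t (hg t).hasDerivAt
  have hdb : ∀ t, HasDerivAt b (L (deriv g t)) t := fun t =>
    L.hasFDerivAt.comp_hasDerivAt t (hg t).hasDerivAt
  have hadiff : Differentiable ℂ a := fun t => (hda t).differentiableAt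
  have hbdiff : Differentiable ℂ b := fun t => (hdb t).differentiableAt
  have hka : Differentiable ℂ (dslope a 0) := by
    rw [← differentiableOn_univ]
    exact (Complex.differentiableOn_dslope univ_mem).2 hadiff.differentiableOn
  have hkb : Differentiable ℂ (dslope b 0) := by
    rw [← differentiableOn_univ]
    exact (Complex.differentiableOn_dslope univ_mem).2 hbdiff.differentiableOn
  have ha0 : a 0 = 0 := by simp [ha, h0]
  have hb0 : b 0 = 0 := by simp [hb, h0]
  have hka0 : dslope a 0 0 ≠ 0 := by
    rw [dslope_same, (hda 0).deriv, hd, hAw]; exact pow_ne_zero 2 hwn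
  have hkb0 : dslope b 0 0 = 0 := by
    rw [dslope_same, (hdb 0).deriv, hd, hLw]
  obtain ⟨ε, hε, hball⟩ := Metric.eventually_nhds_iff_ball.1
    (hka.continuous.continuousAt.eventually_ne hka0)
  set r : ℂ → E := fun t => (dslope a 0 t)⁻¹ • dslope b 0 t with hr
  have hrd : DifferentiableOn ℂ r (Metric.ball 0 ε) := fun t ht =>
    (((hka t).inv (hball t ht)).smul (hkb t)).differentiableWithinAt
  have hane : ∀ t ∈ Metric.ball (0:ℂ) ε, t ≠ 0 → a t ≠ 0 := by
    intro t ht ht0 h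
    apply hball t ht
    rw [dslope_of_ne _ ht0, slope_def_field, h, ha0]; simp
  have hreq : ∀ t, t ≠ 0 → r t = (a t)⁻¹ • b t := by
    intro t ht
    simp only [hr]
    rw [dslope_of_ne _ ht, dslope_of_ne _ ht, slope_def_field, slope_def_module, ha0, hb0]
    simp only [sub_zero, smul_smul]
    congr 1
    field_simp
  have hder : ∀ t ∈ Metric.ball (0:ℂ) ε, t ≠ 0 → deriv r t = 0 := by
    intro t ht ht0
    have heq : r =ᶠ[𝓝 t] fun t => (a t)⁻¹ • b t := by
      filter_upwards [isOpen_ne.mem_nhds ht0] with s hs using hreq s hs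
    rw [heq.deriv_eq]
    obtain ⟨c, hc⟩ := hpar t ht0
    have h1 := ((hda t).inv (hane t ht ht0)).smul (hdb t)
    have h2 := h1.deriv
    refine h2.trans ?_
    rw [hc, map_smul, map_smul]
    change (a t)⁻¹ • c • b t + (-(c • a t) / a t ^ 2) • b t = 0
    have := hane t ht ht0
    rw [smul_smul, ← add_smul]
    have : (a t)⁻¹ * c + -(c • a t) / a t ^ 2 = 0 := by
      rw [smul_eq_mul]; field_simp; ring
    rw [this, zero_smul]
  have hder0 : deriv r 0 = 0 := by
    have hcont : ContinuousAt (deriv r) 0 :=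
      (hrd.analyticAt (Metric.ball_mem_nhds _ hε)).deriv.continuousAt
    have h1 : Tendsto (deriv r) (𝓝[≠] 0) (𝓝 (deriv r 0)) :=
      hcont.tendsto.mono_left nhdsWithin_le_nhds
    have h2 : Tendsto (deriv r) (𝓝[≠] 0) (𝓝 0) := by
      refine tendsto_const_nhds.congr' ?_
      filter_upwards [self_mem_nhdsWithin,
        mem_nhdsWithin_of_mem_nhds (Metric.ball_mem_nhds (0:ℂ) hε)] with t ht ht2
      exact (hder t ht2 ht).symm
    exact tendsto_nhds_unique h1 h2
  have hb_ev : b =ᶠ[𝓝 0] 0 := by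
    filter_upwards [Metric.ball_mem_nhds (0:ℂ) hε] with t ht
    by_cases ht0 : t = 0
    · rw [ht0, hb0]; rfl
    have h1 := Metric.isOpen_ball.is_const_of_deriv_eq_zero
      (convex_ball (0:ℂ) ε).isPreconnected hrd (fun s hs => by
        by_cases hs0 : s = 0
        · rw [hs0, hder0]; rfl
        · rw [hder s hs hs0]; rfl) ht (Metric.mem_ball_self hε)
    have h2 : r 0 = 0 := by simp only [hr, hkb0, smul_zero]
    rw [h2, hreq t ht0, smul_eq_zero, inv_eq_zero] at h1
    exact h1.resolve_left (hane t ht ht0)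
  have hbz : b = 0 := AnalyticOnNhd.eq_of_eventuallyEq (z₀ := 0)
    (fun t _ => hbdiff.analyticAt t) (fun t _ => analyticAt_const) hb_ev
  intro t
  have := congrFun hbz t
  simp only [hb, hLa, Pi.zero_apply] at this
  exact sub_eq_zero.1 this


lemma levi_local {n : ℕ} (F G : EuclideanSpace ℂ (Fin n) → EuclideanSpace ℂ (Fin n))
    (hF : Differentiable ℂ F) (hG : Differentiable ℂ G) (z v : EuclideanSpace ℂ (Fin n))
    (hFz : F z ≠ 0) (hGz : G z ≠ 0)
    (hl : levi (fun x => Real.log (‖F x‖ / ‖G x‖)) z v v = 0) :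
    ‖fderiv ℂ F z v‖ ^ 2 / ‖F z‖ ^ 2 - ‖inner ℂ (F z) (fderiv ℂ F z v)‖ ^ 2 / ‖F z‖ ^ 4 =
    ‖fderiv ℂ G z v‖ ^ 2 / ‖G z‖ ^ 2 - ‖inner ℂ (G z) (fderiv ℂ G z v)‖ ^ 2 / ‖G z‖ ^ 4 := by
  set g : EuclideanSpace ℂ (Fin n) → ℝ := fun x => Real.log (‖F x‖ / ‖G x‖) with hg
  have hsm : ∀ F : EuclideanSpace ℂ (Fin n) → EuclideanSpace ℂ (Fin n), Differentiable ℂ F →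
      F z ≠ 0 → ContDiffAt ℝ 2 (fun x => ‖F x‖) z := by
    intro F hF hFz
    exact ((contDiff_two F hF).restrict_scalars ℝ).contDiffAt.norm ℂ hFz
  have hgc : ContDiffAt ℝ 2 g z :=
    ((hsm F hF hFz).div (hsm G hG hGz) (by simpa using hGz)).log
      (div_ne_zero (by simpa using hFz) (by simpa using hGz))
  have hline : ∀ F : EuclideanSpace ℂ (Fin n) → EuclideanSpace ℂ (Fin n), Differentiable ℂ F →
      ∃ f2, (∀ t : ℂ, HasDerivAt (fun t : ℂ => F (z + t • v)) (fderiv ℂ F (z + t • v) v) t) ∧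
        HasDerivAt (fun t : ℂ => fderiv ℂ F (z + t • v) v) f2 0 := by
    intro F hF
    have hd : ∀ t : ℂ, HasDerivAt (fun t : ℂ => z + t • v) v t := fun t => by
      simpa using ((hasDerivAt_id t).smul_const v).const_add z
    refine ⟨deriv (fun t : ℂ => fderiv ℂ F (z + t • v) v) 0, fun t => ?_, ?_⟩
    · exact (hF _).hasFDerivAt.comp_hasDerivAt t (hd t)
    · have h1 := differentiable_fderiv_apply F hF v
      have h2 : DifferentiableAt ℂ (fun t : ℂ => fderiv ℂ F (z + t • v) v) 0 :=
        DifferentiableAt.comp (g := fun x => fderiv ℂ F x v) (0:ℂ)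
          (h1 (z + (0:ℂ) • v)) (hd 0).differentiableAt
      exact h2.hasDerivAt
  obtain ⟨f2, hf, hf2⟩ := hline F hF
  obtain ⟨g2, hg1, hg2⟩ := hline G hG
  have hdir : ∀ c : ℂ, iteratedFDeriv ℝ 2 g z ![c • v, c • v] =
      ((‖c • fderiv ℂ F z v‖ ^ 2 + (inner ℂ (F z) (c • c • f2)).re) / ‖F z‖ ^ 2
        - 2 * (inner ℂ (F z) (c • fderiv ℂ F z v)).re ^ 2 / ‖F z‖ ^ 4) -
      ((‖c • fderiv ℂ G z v‖ ^ 2 + (inner ℂ (G z) (c • c • g2)).re) / ‖G z‖ ^ 2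
        - 2 * (inner ℂ (G z) (c • fderiv ℂ G z v)).re ^ 2 / ‖G z‖ ^ 4) := by
    intro c
    obtain ⟨p, hp, hp'⟩ := dir_deriv F z v _ f2 hf hf2 hFz c
    obtain ⟨q, hq, hq'⟩ := dir_deriv G z v _ g2 hg1 hg2 hGz c
    simp only [zero_smul, add_zero] at hp' hq'
    refine iterated_two_of_line g z (c • v) hgc (fun s => p s - q s) _ ?_ (hp'.sub hq')
    have hcl : Tendsto (fun s : ℝ => z + s • (c • v)) (𝓝 0) (𝓝 z) := by
      have : Continuous (fun s : ℝ => z + s • (c • v)) := by fun_prop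
      simpa using this.tendsto 0
    have hFe : ∀ᶠ x in 𝓝 z, F x ≠ 0 := hF.continuous.continuousAt.eventually_ne hFz
    have hGe : ∀ᶠ x in 𝓝 z, G x ≠ 0 := hG.continuous.continuousAt.eventually_ne hGz
    filter_upwards [hp, hq, (hcl.eventually (hFe.and hGe)).eventually_nhds] with s h1 h2 h3
    refine (h1.sub h2).congr_of_eventuallyEq ?_
    filter_upwards [h3] with u hu
    simp only [hg, Pi.sub_apply]
    rw [Real.log_div (by simpa using hu.1) (by simpa using hu.2)]
  have hre := congrArg Complex.re hl
  have hsum : iteratedFDeriv ℝ 2 g z ![v, v] +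
      iteratedFDeriv ℝ 2 g z ![Complex.I • v, Complex.I • v] = 0 := by
    rw [levi] at hl
    have h4 : (1/4 : ℂ) ≠ 0 := by norm_num
    have := (mul_eq_zero.1 hl).resolve_left h4
    have := congrArg Complex.re this
    simpa using this
  have h1 := hdir 1
  have hI := hdir Complex.I
  have e1 := sum_dirs (F z) (fderiv ℂ F z v) f2
  have e2 := sum_dirs (G z) (fderiv ℂ G z v) g2
  rw [one_smul ℂ v] at h1
  rw [h1, hI] at hsum
  linarith

/-- Every complex line through `0` is preserved by `F ∘ Ginv`. -/
lemma line_preserved {E : Type*} [NormedAddCommGroup E] [InnerProductSpace ℂ E] [CompleteSpace E]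
    (F G Finv Ginv : E → E) (hF : Differentiable ℂ F) (hG : Differentiable ℂ G)
    (hGinv : Differentiable ℂ Ginv) (hFl : Function.LeftInverse Finv F)
    (hGl : Function.LeftInverse Ginv G) (hGr : Function.RightInverse Ginv G)
    (hF0 : F 0 = 0) (hG0 : G 0 = 0)
    (hDF : fderiv ℂ F 0 = ContinuousLinearMap.id ℂ E)
    (hDG : fderiv ℂ G 0 = ContinuousLinearMap.id ℂ E)
    (hA : ∀ z, z ≠ 0 → ∀ v,
      ‖fderiv ℂ F z v‖ ^ 2 / ‖F z‖ ^ 2 - ‖inner ℂ (F z) (fderiv ℂ F z v)‖ ^ 2 / ‖F z‖ ^ 4 =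
      ‖fderiv ℂ G z v‖ ^ 2 / ‖G z‖ ^ 2 - ‖inner ℂ (G z) (fderiv ℂ G z v)‖ ^ 2 / ‖G z‖ ^ 4)
    (w : E) (hw : w ≠ 0) :
    ∃ p : ℂ → ℂ, Differentiable ℂ p ∧ p 0 = 0 ∧ deriv p 0 = 1 ∧
      ∀ t : ℂ, F (Ginv (t • w)) = p t • w := by
  have hGi0 : Ginv 0 = 0 := by rw [← hG0, hGl]; exact hG0.symm
  have hwn : (‖w‖ : ℂ) ≠ 0 := by simpa using hw
  have hl : ∀ t : ℂ, HasDerivAt (fun t : ℂ => t • w) w t := fun t => by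
    simpa using (hasDerivAt_id t).smul_const w
  have hγ : ∀ t : ℂ, HasDerivAt (fun t : ℂ => Ginv (t • w)) (fderiv ℂ Ginv (t • w) w) t :=
    fun t => (hGinv _).hasFDerivAt.comp_hasDerivAt t (hl t)
  have hGγ : ∀ t : ℂ, fderiv ℂ G (Ginv (t • w)) (fderiv ℂ Ginv (t • w) w) = w := by
    intro t
    have h1 := (hG (Ginv (t • w))).hasFDerivAt.comp_hasDerivAt t (hγ t)
    have h2 : (G ∘ fun t : ℂ => Ginv (t • w)) = fun t : ℂ => t • w := by
      funext t; exact hGr _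
    rw [h2] at h1
    exact h1.unique (hl t)
  have hFγ : ∀ t : ℂ, HasDerivAt (fun t : ℂ => F (Ginv (t • w)))
      (fderiv ℂ F (Ginv (t • w)) (fderiv ℂ Ginv (t • w) w)) t :=
    fun t => (hF (Ginv (t • w))).hasFDerivAt.comp_hasDerivAt t (hγ t)
  have hg : Differentiable ℂ (fun t : ℂ => F (Ginv (t • w))) := fun t => (hFγ t).differentiableAt
  have hg0 : F (Ginv ((0:ℂ) • w)) = 0 := by simp [hGi0, hF0]
  have hd : deriv (fun t : ℂ => F (Ginv (t • w))) 0 = w := by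
    rw [(hFγ 0).deriv]
    have := hGγ 0
    simp only [zero_smul, hGi0, hDG, hDF, ContinuousLinearMap.id_apply] at this ⊢
    exact this
  have hline := curve_in_line (fun t : ℂ => F (Ginv (t • w))) w hw hg hg0 hd (by
    intro t ht
    rw [(hFγ t).deriv]
    have htw : t • w ≠ 0 := smul_ne_zero ht hw
    have hz : Ginv (t • w) ≠ 0 := by
      intro h; apply htw; rw [← hGr (t • w), h, hG0]
    have hFz : F (Ginv (t • w)) ≠ 0 := by
      intro h; apply hz; rw [← hFl (Ginv (t • w)), h]
      conv_lhs => rw [← hF0]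
      exact hFl 0
    have h1 := hA _ hz (fderiv ℂ Ginv (t • w) w)
    rw [hGγ, hGr] at h1
    have h2 : ‖w‖ ^ 2 / ‖t • w‖ ^ 2 - ‖inner ℂ (t • w) w‖ ^ 2 / ‖t • w‖ ^ 4 = 0 := by
      have hn : ‖w‖ ≠ 0 := by simpa using hw
      have ht' : ‖t‖ ≠ 0 := by simpa using ht
      have : ‖inner ℂ (t • w) w‖ = ‖t‖ * ‖w‖ ^ 2 := by
        rw [inner_smul_left, inner_self_eq_norm_sq_to_K]; simp
      rw [this, norm_smul]; field_simp; ring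
    rw [h2] at h1
    set x := F (Ginv (t • w))
    set y := fderiv ℂ F (Ginv (t • w)) (fderiv ℂ Ginv (t • w) w)
    by_cases hy : y = 0
    · exact ⟨0, by simp [hy]⟩
    have hx : ‖x‖ ≠ 0 := by simpa using hFz
    have h3 : ‖inner ℂ x y‖ ^ 2 = (‖x‖ * ‖y‖) ^ 2 := by
      field_simp at h1
      nlinarith
    have h4 : ‖inner ℂ x y‖ = ‖x‖ * ‖y‖ := by
      exact (pow_left_inj₀ (norm_nonneg _) (by positivity) two_ne_zero).1 h3
    obtain ⟨r, -, hr⟩ := (norm_inner_eq_norm_iff hFz hy).1 h4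
    exact ⟨r, hr⟩)
  have hp : ∀ t, HasDerivAt (fun t : ℂ => inner ℂ w (F (Ginv (t • w))) / (‖w‖ : ℂ) ^ 2)
      (inner ℂ w (deriv (fun t : ℂ => F (Ginv (t • w))) t) / (‖w‖ : ℂ) ^ 2) t := fun t =>
    ((innerSL ℂ w).hasFDerivAt.comp_hasDerivAt t (hg t).hasDerivAt).div_const _
  refine ⟨fun t => inner ℂ w (F (Ginv (t • w))) / (‖w‖ : ℂ) ^ 2,
    fun t => (hp t).differentiableAt, ?_, ?_, hline⟩
  · simp only [hg0, inner_zero_right, zero_div]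
  · rw [(hp 0).deriv, hd, inner_self_eq_norm_sq_to_K]
    exact div_self (pow_ne_zero 2 hwn)

theorem normalized_automorphisms_eq_of_log_ratio_pluriharmonic {n : ℕ} (hn : 2 ≤ n)
    (F G : EuclideanSpace ℂ (Fin n) → EuclideanSpace ℂ (Fin n))
    (hF : Differentiable ℂ F) (hG : Differentiable ℂ G)
    (Finv Ginv : EuclideanSpace ℂ (Fin n) → EuclideanSpace ℂ (Fin n))
    (hFinv : Differentiable ℂ Finv) (hGinv : Differentiable ℂ Ginv)
    (hFl : Function.LeftInverse Finv F) (hFr : Function.RightInverse Finv F)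
    (hGl : Function.LeftInverse Ginv G) (hGr : Function.RightInverse Ginv G)
    (hF0 : F 0 = 0) (hG0 : G 0 = 0)
    (hDF : fderiv ℂ F 0 = ContinuousLinearMap.id ℂ (EuclideanSpace ℂ (Fin n)))
    (hDG : fderiv ℂ G 0 = ContinuousLinearMap.id ℂ (EuclideanSpace ℂ (Fin n)))
    (hph : ∀ z : EuclideanSpace ℂ (Fin n), z ≠ 0 → ∀ v w,
      levi (fun x => Real.log (‖F x‖ / ‖G x‖)) z v w = 0) :
    F = G := by
  have hne : ∀ F Finv : EuclideanSpace ℂ (Fin n) → EuclideanSpace ℂ (Fin n),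
      Function.LeftInverse Finv F → F 0 = 0 → ∀ z, z ≠ 0 → F z ≠ 0 := by
    intro F Finv hl h0 z hz h
    exact hz (hl.injective (h.trans h0.symm))
  have hA := fun z hz v => levi_local F G hF hG z v (hne F Finv hFl hF0 z hz)
    (hne G Ginv hGl hG0 z hz) (hph z hz v v)
  have key : ∀ w, F (Ginv w) = w := by
    intro w
    by_cases hw : w = 0
    · subst hw
      have : Ginv 0 = 0 := by
        conv_lhs => rw [← hG0]
        exact hGl 0
      rw [this, hF0]
    obtain ⟨p, hp, hp0, hp1, hpe⟩ := line_preserved F G Finv Ginv hF hG hGinv hFl hGl hGr hF0 hG0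
      hDF hDG hA w hw
    obtain ⟨q, hq, hq0, hq1, hqe⟩ := line_preserved G F Ginv Finv hG hF hFinv hGl hFl hFr hG0 hF0
      hDG hDF (fun z hz v => (hA z hz v).symm) w hw
    have hid := entire_aut_eq_id p q hp hq (fun x => by
      apply smul_left_injective ℂ hw
      change p (q x) • w = x • w
      rw [← hpe, ← hqe, hGl, hFr]) (fun x => by
      apply smul_left_injective ℂ hw
      change q (p x) • w = x • w
      rw [← hqe, ← hpe, hFl, hGr]) hp0 hp1
    have := hpe 1
    rw [hid 1, one_smul] at this
    exact this
  funext z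
  have := key (G z)
  rw [hGl] at this
  exact this
end

section
/- If u is a pluriharmonic function on ℂⁿ \ {0} with n ≥ 2, then u extends to a pluriharmonic function on all of ℂⁿ, and u = Re f for some entire function f : ℂⁿ → ℂ. -/
open Real MeasureTheory Set Filter Topology

theorem avg_hasFDerivAt {E V : Type*} [NormedAddCommGroup E] [NormedSpace ℂ E] [ProperSpace E]
    [NormedAddCommGroup V] [NormedSpace ℝ V] [CompleteSpace V]
    (G : E → V) (hG : ContDiffOn ℝ 1 G {0}ᶜ) (e : E) (he : ‖e‖ = 1) (z : E) (hz : ‖z‖ < 1) :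
    HasFDerivAt (fun z => ∫ θ in (0:ℝ)..2 * π, G (z + circleMap 0 1 θ • e))
      (∫ θ in (0:ℝ)..2 * π, fderiv ℝ G (z + circleMap 0 1 θ • e)) z := by
  obtain ⟨r, hzr, hr⟩ := exists_between hz
  have hcm : ∀ θ : ℝ, ‖circleMap 0 1 θ • e‖ = 1 := fun θ => by
    rw [norm_smul, he]; simp
  have hr1 : ∀ x : E, ‖x‖ < 1 → ∀ θ : ℝ, x + circleMap 0 1 θ • e ∈ ({0}ᶜ : Set E) := by
    intro x hx θ h0
    have h0' : x = -(circleMap 0 1 θ • e) := eq_neg_of_add_eq_zero_left h0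
    rw [h0', norm_neg, hcm] at hx
    exact lt_irrefl _ hx
  have hcont : Continuous fun θ : ℝ => circleMap 0 1 θ • e := 
    (continuous_circleMap 0 1).smul continuous_const
  have hGc : ContinuousOn G {0}ᶜ := hG.continuousOn
  have hG'c : ContinuousOn (fderiv ℝ G) {0}ᶜ :=
    hG.continuousOn_fderiv_of_isOpen isOpen_compl_singleton le_rfl
  have hcG : ∀ x : E, ‖x‖ < 1 → Continuous fun θ : ℝ => G (x + circleMap 0 1 θ • e) := 
    fun x hx => hGc.comp_continuous (continuous_const.add hcont) (hr1 x hx)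
  have hcG' : ∀ x : E, ‖x‖ < 1 → Continuous fun θ : ℝ => fderiv ℝ G (x + circleMap 0 1 θ • e) := 
    fun x hx => hG'c.comp_continuous (continuous_const.add hcont) (hr1 x hx)
  have hK : IsCompact {x : E | 1 - r ≤ ‖x‖ ∧ ‖x‖ ≤ 2} := by
    refine (isCompact_closedBall (0:E) 2).of_isClosed_subset ?_ ?_
    · exact (isClosed_le continuous_const continuous_norm).inter
        (isClosed_le continuous_norm continuous_const)
    · rintro x ⟨_, hx⟩
      simpa using hx
  obtain ⟨C, hC⟩ := hK.exists_bound_of_continuousOn (f := fderiv ℝ G) (hG'c.mono (by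
    rintro x ⟨hx, _⟩ h0
    rw [mem_singleton_iff] at h0
    rw [h0, norm_zero] at hx
    linarith))
  refine intervalIntegral.hasFDerivAt_integral_of_dominated_of_fderiv_le
    (s := Metric.ball 0 r) (bound := fun _ => C) 
    (F' := fun x θ => fderiv ℝ G (x + circleMap 0 1 θ • e))
    (Metric.isOpen_ball.mem_nhds (by simpa using hzr)) ?_ ?_ ?_ ?_ ?_ ?_
  · filter_upwards [Metric.isOpen_ball.mem_nhds (show z ∈ Metric.ball (0:E) 1 by simpa using hz)]
      with x hx
    exact (hcG x (by simpa using hx)).aestronglyMeasurable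
  · exact (hcG z hz).intervalIntegrable _ _
  · exact (hcG' z hz).aestronglyMeasurable
  · refine Eventually.of_forall fun θ _ x hx => hC _ ⟨?_, ?_⟩
    · have := norm_sub_norm_le (circleMap 0 1 θ • e) (-x)
      rw [hcm, norm_neg, sub_neg_eq_add, add_comm (circleMap 0 1 θ • e)] at this
      have hx' : ‖x‖ < r := by simpa using hx
      linarith
    · have := norm_add_le x (circleMap 0 1 θ • e)
      rw [hcm] at this
      have hx' : ‖x‖ < r := by simpa using hx
      linarith
  · exact intervalIntegrable_const
  · refine Eventually.of_forall fun θ _ x hx => ?_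
    have hx' : ‖x‖ < r := by simpa using hx
    have h1 := hr1 x (by linarith) θ
    have h2 : HasFDerivAt G (fderiv ℝ G (x + circleMap 0 1 θ • e)) (x + circleMap 0 1 θ • e) :=
      ((hG.contDiffAt (isOpen_compl_singleton.mem_nhds h1)).differentiableAt
        (by norm_num)).hasFDerivAt
    exact (hasFDerivAt_comp_add_right (circleMap 0 1 θ • e)).2 h2

theorem avg_eq {E V : Type*} [NormedAddCommGroup E] [NormedSpace ℂ E] 
    [NormedAddCommGroup V] [NormedSpace ℂ V] [CompleteSpace V]
    (G : E → V) (hG : ∀ z, z ≠ 0 → DifferentiableAt ℂ G z) (e : E) (z : E)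
    (hz : ∀ c : ℂ, z + c • e ≠ 0) :
    ∫ θ in (0:ℝ)..2 * π, G (z + circleMap 0 1 θ • e) = (2 * π) • G z := by
  have hd : Differentiable ℂ fun c : ℂ => G (z + c • e) := fun c =>
    (hG _ (hz c)).comp (f := fun c : ℂ => z + c • e) c (by fun_prop)
  have := (hd.diffContOnCl (s := Metric.ball 0 |1|)).circleAverage
  rw [circleAverage_def] at this
  simp only [zero_smul, add_zero] at this
  rw [← this, smul_smul, mul_inv_cancel₀ (by positivity), one_smul]

theorem pluriharmonic_extends_re_entire {n : ℕ} (hn : 2 ≤ n)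
    (u : EuclideanSpace ℂ (Fin n) → ℝ)
    (hu : ContDiffOn ℝ 2 u {0}ᶜ)
    (hph : ∀ z : EuclideanSpace ℂ (Fin n), z ≠ 0 → ∀ v w, levi u z v w = 0) :
    ∃ f : EuclideanSpace ℂ (Fin n) → ℂ, Differentiable ℂ f ∧
      ∀ z : EuclideanSpace ℂ (Fin n), z ≠ 0 → u z = (f z).re := by
  classical
  have hopen : IsOpen ({0}ᶜ : Set (EuclideanSpace ℂ (Fin n))) := isOpen_compl_singleton
  -- the complexification of real functionals
  let Φ : ((EuclideanSpace ℂ (Fin n)) →L[ℝ] ℝ) →L[ℝ] ((EuclideanSpace ℂ (Fin n)) →L[ℂ] ℂ) :=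
    ((StrongDual.extendRCLikeₗᵢ (𝕜 := ℂ) (F := (EuclideanSpace ℂ (Fin n)))).toContinuousLinearEquiv :
      ((EuclideanSpace ℂ (Fin n)) →L[ℝ] ℝ) →L[ℝ] ((EuclideanSpace ℂ (Fin n)) →L[ℂ] ℂ))
  have hΦ : ∀ (l : (EuclideanSpace ℂ (Fin n)) →L[ℝ] ℝ) (v : (EuclideanSpace ℂ (Fin n))), Φ l v = (l v : ℂ) - Complex.I * (l (Complex.I • v) : ℂ) :=
    fun l v => StrongDual.extendRCLike_apply l v
  have hu' : ContDiffOn ℝ 1 (fderiv ℝ u) {0}ᶜ := hu.fderiv_of_isOpen hopen (by norm_num : (1 : WithTop ℕ∞) + 1 ≤ 2)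
  let ω : (EuclideanSpace ℂ (Fin n)) → ((EuclideanSpace ℂ (Fin n)) →L[ℂ] ℂ) := fun z => Φ (fderiv ℝ u z)
  have hω : ContDiffOn ℝ 1 ω {0}ᶜ := Φ.contDiff.comp_contDiffOn hu'
  have hωd : ∀ z : (EuclideanSpace ℂ (Fin n)), z ≠ 0 → HasFDerivAt ω (Φ.comp (fderiv ℝ (fderiv ℝ u) z)) z := by
    intro z hz
    have h1 : DifferentiableAt ℝ (fderiv ℝ u) z :=
      (hu'.contDiffAt (hopen.mem_nhds hz)).differentiableAt (by norm_num)
    exact Φ.hasFDerivAt.comp z h1.hasFDerivAt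
  -- second derivative identities
  have hsymm : ∀ z : (EuclideanSpace ℂ (Fin n)), z ≠ 0 → ∀ v w, fderiv ℝ (fderiv ℝ u) z v w = fderiv ℝ (fderiv ℝ u) z w v :=
    fun z hz v w => ((hu.contDiffAt (hopen.mem_nhds hz)).isSymmSndFDerivAt (by simp)).eq v w
  have hlev : ∀ z : (EuclideanSpace ℂ (Fin n)), z ≠ 0 → ∀ v w,
      fderiv ℝ (fderiv ℝ u) z v w + fderiv ℝ (fderiv ℝ u) z (Complex.I • v) (Complex.I • w) = 0 ∧
      fderiv ℝ (fderiv ℝ u) z (Complex.I • v) w = fderiv ℝ (fderiv ℝ u) z v (Complex.I • w) := by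
    intro z hz v w
    have h := hph z hz v w
    unfold levi at h
    simp only [iteratedFDeriv_two_apply, Matrix.cons_val_zero, Matrix.cons_val_one] at h
    have h2 := (mul_eq_zero.1 h).resolve_left (by norm_num)
    have hre := congrArg Complex.re h2
    have him := congrArg Complex.im h2
    simp only [Complex.add_re, Complex.add_im, Complex.mul_re, Complex.mul_im, Complex.I_re,
      Complex.I_im, Complex.ofReal_re, Complex.ofReal_im, Complex.zero_re, Complex.zero_im] at hre him
    constructor <;> linarith
  have hωsymm : ∀ z : (EuclideanSpace ℂ (Fin n)), z ≠ 0 → ∀ v w, fderiv ℝ ω z v w = fderiv ℝ ω z w v := by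
    intro z hz v w
    rw [(hωd z hz).fderiv]
    simp only [ContinuousLinearMap.comp_apply, hΦ]
    rw [hsymm z hz v w, ← (hlev z hz v w).2, hsymm z hz (Complex.I • v) w]
  have hωC : ∀ z : (EuclideanSpace ℂ (Fin n)), z ≠ 0 → DifferentiableAt ℂ ω z := by
    intro z hz
    let L : (EuclideanSpace ℂ (Fin n)) →L[ℂ] ((EuclideanSpace ℂ (Fin n)) →L[ℂ] ℂ) :=
      { toFun := fun v => Φ (fderiv ℝ (fderiv ℝ u) z v)
        map_add' := fun v w => by rw [map_add, map_add]
        map_smul' := by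
          intro c v
          have hI : Φ (fderiv ℝ (fderiv ℝ u) z (Complex.I • v))
              = Complex.I • Φ (fderiv ℝ (fderiv ℝ u) z v) := by
            ext w
            have h1 := (hlev z hz v w).1
            have h2 := (hlev z hz v w).2
            have h3 : fderiv ℝ (fderiv ℝ u) z (Complex.I • v) (Complex.I • w)
              = - fderiv ℝ (fderiv ℝ u) z v w := by linarith
            rw [smul_apply, hΦ, hΦ, h2, h3, smul_eq_mul]
            push_cast
            linear_combination (fderiv ℝ (fderiv ℝ u) z v (Complex.I • w) : ℂ) * Complex.I_sq
          have hc : c • v = c.re • v + c.im • (Complex.I • v) := by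
            conv_lhs => rw [← Complex.re_add_im c]
            rw [add_smul, mul_smul]; rfl
          rw [RingHom.id_apply, hc, map_add, map_add, map_smul, map_smul, map_smul, map_smul, hI]
          conv_rhs => rw [← Complex.re_add_im c]
          rw [add_smul, mul_smul]; rfl
        cont := (Φ.comp (fderiv ℝ (fderiv ℝ u) z)).continuous }
    exact (hasFDerivAt_of_restrictScalars (f' := L) ℝ (hωd z hz) rfl).differentiableAt
  -- the average
  let i0 : Fin n := ⟨0, by omega⟩
  let i1 : Fin n := ⟨1, by omega⟩
  have hi : i1 ≠ i0 := by simp [i0, i1]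
  let e : EuclideanSpace ℂ (Fin n) := EuclideanSpace.single i0 1
  let e' : EuclideanSpace ℂ (Fin n) := EuclideanSpace.single i1 1
  have he : ‖e‖ = 1 := by simp [e]
  let A : (EuclideanSpace ℂ (Fin n)) → ((EuclideanSpace ℂ (Fin n)) →L[ℂ] ℂ) := fun z =>
    (2 * π)⁻¹ • ∫ θ in (0:ℝ)..2 * π, ω (z + circleMap 0 1 θ • e)
  let A' : (EuclideanSpace ℂ (Fin n)) → (EuclideanSpace ℂ (Fin n)) →L[ℝ] ((EuclideanSpace ℂ (Fin n)) →L[ℂ] ℂ) := fun z =>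
    (2 * π)⁻¹ • ∫ θ in (0:ℝ)..2 * π, fderiv ℝ ω (z + circleMap 0 1 θ • e)
  have hA : ∀ z : (EuclideanSpace ℂ (Fin n)), ‖z‖ < 1 → HasFDerivAt A (A' z) z := fun z hz =>
    (avg_hasFDerivAt ω hω e he z hz).const_smul (2 * π)⁻¹
  have hAeq1 : ∀ z : (EuclideanSpace ℂ (Fin n)), z i1 ≠ 0 → A z = ω z := by
    intro z hz
    have := avg_eq ω hωC e z (by
      intro c hc
      apply hz
      have := congrArg (fun x : (EuclideanSpace ℂ (Fin n)) => x i1) hc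
      simpa [e, hi] using this)
    simp only [A]
    rw [this, smul_smul, inv_mul_cancel₀ (by positivity), one_smul]
  have hAeq : ∀ z : (EuclideanSpace ℂ (Fin n)), ‖z‖ < 1 → z ≠ 0 → A z = ω z := by
    intro z hz hz0
    by_cases h1 : z i1 = 0
    · have hline : Tendsto (fun t : ℂ => z + t • e') (𝓝[≠] 0) (𝓝 z) := by
        have : Continuous fun t : ℂ => z + t • e' := by fun_prop
        have h := this.tendsto 0
        simp only [zero_smul, add_zero] at h
        exact h.mono_left nhdsWithin_le_nhds
      have hA1 := (hA z hz).continuousAt.tendsto.comp hline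
      have hω1 := (hωd z hz0).continuousAt.tendsto.comp hline
      refine tendsto_nhds_unique hA1 (hω1.congr' ?_)
      filter_upwards [self_mem_nhdsWithin] with t ht
      refine (hAeq1 _ ?_).symm
      simpa [e', h1] using ht
    · exact hAeq1 z h1
  have hA'symm : ∀ v w, A' 0 v w = A' 0 w v := by
    have hne : ∀ θ : ℝ, (0:(EuclideanSpace ℂ (Fin n))) + circleMap 0 1 θ • e ≠ 0 := by
      intro θ h
      have := congrArg norm h
      rw [zero_add, norm_smul, he] at this
      simp at this
    have hcont : Continuous fun θ : ℝ => fderiv ℝ ω (0 + circleMap 0 1 θ • e) :=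
      (hω.continuousOn_fderiv_of_isOpen hopen le_rfl).comp_continuous
        (continuous_const.add ((continuous_circleMap 0 1).smul continuous_const)) hne
    have key : ∀ v w, (∫ θ in (0:ℝ)..2 * π, fderiv ℝ ω (0 + circleMap 0 1 θ • e)) v w
        = ∫ θ in (0:ℝ)..2 * π, fderiv ℝ ω (0 + circleMap 0 1 θ • e) v w := by
      intro v w
      rw [ContinuousLinearMap.intervalIntegral_apply (hcont.intervalIntegrable _ _)]
      have h2 : Continuous fun θ : ℝ => fderiv ℝ ω (0 + circleMap 0 1 θ • e) v :=
        hcont.clm_apply continuous_const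
      rw [ContinuousLinearMap.intervalIntegral_apply (h2.intervalIntegrable _ _)]
    intro v w
    simp only [A', smul_apply, key]
    simp_rw [fun θ => hωsymm _ (hne θ) v w]
  -- the extended form
  let ωt : (EuclideanSpace ℂ (Fin n)) → ((EuclideanSpace ℂ (Fin n)) →L[ℂ] ℂ) := Function.update ω 0 (A 0)
  have hωt : ∀ z : (EuclideanSpace ℂ (Fin n)), z ≠ 0 → ωt =ᶠ[𝓝 z] ω := by
    intro z hz
    filter_upwards [hopen.mem_nhds hz] with x hx
    exact Function.update_of_ne hx _ _
  have hωt0 : ωt =ᶠ[𝓝 0] A := by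
    filter_upwards [Metric.ball_mem_nhds (0:(EuclideanSpace ℂ (Fin n))) one_pos] with x hx
    by_cases h0 : x = 0
    · subst h0; simp [ωt]
    · rw [show ωt x = ω x from Function.update_of_ne h0 _ _]
      exact (hAeq x (by simpa using hx) h0).symm
  have hdiff : ∀ z : (EuclideanSpace ℂ (Fin n)), DifferentiableAt ℝ ωt z ∧ ∀ v w, fderiv ℝ ωt z v w = fderiv ℝ ωt z w v := by
    intro z
    by_cases hz : z = 0
    · subst hz
      have h := (hA 0 (by simp)).congr_of_eventuallyEq hωt0
      exact ⟨h.differentiableAt, by rw [h.fderiv]; exact hA'symm⟩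
    · refine ⟨((hωd z hz).congr_of_eventuallyEq (hωt z hz)).differentiableAt, ?_⟩
      rw [(hωt z hz).fderiv_eq]
      exact hωsymm z hz
  obtain ⟨f, hf⟩ := (convex_univ (𝕜 := ℝ) (E := EuclideanSpace ℂ (Fin n))).exists_forall_hasFDerivAt_of_fderiv_symmetric
    isOpen_univ (ω := ωt) (fun z _ => (hdiff z).1.differentiableWithinAt)
    (fun z _ => (hdiff z).2)
  have hff : ∀ z : (EuclideanSpace ℂ (Fin n)), HasFDerivAt f (ωt z) z := fun z => hf z (mem_univ z)
  have hpre : IsPreconnected ({0}ᶜ : Set (EuclideanSpace ℂ (Fin n))) := by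
    refine (isConnected_compl_singleton_of_one_lt_rank ?_ 0).isPreconnected
    rw [rank_real_of_complex, ← Module.finrank_eq_rank, finrank_euclideanSpace_fin]
    norm_cast
    omega
  have hg : ∀ z : (EuclideanSpace ℂ (Fin n)), z ≠ 0 → HasFDerivAt (𝕜 := ℝ) (fun z => u z - (f z).re) 0 z := by
    intro z hz
    have h1 : HasFDerivAt u (fderiv ℝ u z) z :=
      ((hu.contDiffAt (hopen.mem_nhds hz)).differentiableAt (by norm_num)).hasFDerivAt
    have h2 := Complex.reCLM.hasFDerivAt.comp z ((hff z).restrictScalars ℝ)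
    refine (h1.sub h2).congr_fderiv ?_
    ext v
    have h3 : ωt z = ω z := Function.update_of_ne hz _ _
    simp [h3, ω, hΦ]
  obtain ⟨a, ha⟩ := hopen.exists_is_const_of_fderiv_eq_zero hpre (𝕜 := ℝ)
    (f := fun z => u z - (f z).re)
    (fun z hz => (hg z hz).differentiableAt.differentiableWithinAt)
    (fun z hz => (hg z hz).fderiv)
  refine ⟨fun z => f z + a, fun z => ((hff z).differentiableAt).add_const _, fun z hz => ?_⟩
  have := ha z hz
  simp only [Complex.add_re, Complex.ofReal_re]
  linarith
end

section
/- Main theorem (normalized version): Let F, G be holomorphic automorphisms of ℂⁿ with F(0) = G(0) = 0 and DF(0) = DG(0) = I. If the complex Hessians of log‖F‖ and log‖G‖ agree on ℂⁿ \ {0}, then F = G. -/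
open Filter Topology MeasureTheory

set_option linter.unusedSectionVars false

section reg
variable {E : Type*} [NormedAddCommGroup E] [NormedSpace ℂ E] [FiniteDimensional ℂ E]

lemma aux_line_diff {F : E → E} (hF : Differentiable ℂ F) (z v : E) :
    Differentiable ℂ (fun τ : ℂ => F (z + τ • v)) := by
  fun_prop

lemma aux_line_deriv {F : E → E} (hF : Differentiable ℂ F) (z v : E) :
    deriv (fun τ : ℂ => F (z + τ • v)) 0 = fderiv ℂ F z v := by
  have h1 : HasDerivAt (fun τ : ℂ => z + τ • v) v 0 := by
    simpa using ((hasDerivAt_id (0:ℂ)).smul_const v).const_add z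
  have h2 : HasFDerivAt F (fderiv ℂ F z) (z + (0:ℂ) • v) := by
    simpa using (hF z).hasFDerivAt
  exact (h2.comp_hasDerivAt (0:ℂ) h1).deriv

lemma aux_fderiv_bound {F : E → E} (hF : Differentiable ℂ F) (R : ℝ) :
    ∃ C : ℝ, 0 ≤ C ∧ ∀ z, ‖z‖ ≤ R → ‖fderiv ℂ F z‖ ≤ C := by
  have : ProperSpace E := FiniteDimensional.proper ℂ E
  obtain ⟨C, hC⟩ := (isCompact_closedBall (0:E) (R+1)).exists_bound_of_continuousOn
    hF.continuous.continuousOn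
  refine ⟨max C 0, le_max_right _ _, fun z hz => ?_⟩
  refine ContinuousLinearMap.opNorm_le_of_unit_norm (le_max_right _ _) fun v hv => ?_
  rw [← aux_line_deriv hF]
  have := Complex.norm_deriv_le_of_forall_mem_sphere_norm_le (c := 0) (R := 1) (C := C) one_pos
    (f := fun τ : ℂ => F (z + τ • v)) (aux_line_diff hF z v).diffContOnCl (fun τ hτ => hC _ ?_)
  · refine this.trans ?_
    simp
  · have h1 : ‖τ‖ = 1 := by simpa using hτ
    have h2 : ‖τ • v‖ = 1 := by rw [norm_smul, h1, hv, one_mul]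
    have := norm_add_le z (τ • v)
    rw [mem_closedBall_zero_iff]
    linarith

lemma aux_fderiv_diff {F : E → E} (hF : Differentiable ℂ F) (v : E) :
    Differentiable ℂ (fun z => fderiv ℂ F z v) := by
  have : ProperSpace E := FiniteDimensional.proper ℂ E
  have : CompleteSpace E := FiniteDimensional.complete ℂ E
  set c : ℝ → ℂ := fun θ => deriv (circleMap 0 1) θ * ((circleMap 0 1 θ - 0) ^ 2)⁻¹ with hc
  have hcc : Continuous c := by
    have h0 : ∀ θ, (circleMap 0 1 θ - 0) ^ 2 ≠ 0 := by
      intro θ; simp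
    have : c = fun θ => (circleMap 0 1 θ * Complex.I) * ((circleMap 0 1 θ - 0) ^ 2)⁻¹ := by
      ext θ; simp [hc, deriv_circleMap]
    rw [this]
    have h1 : Continuous (circleMap 0 1) := continuous_circleMap 0 1
    exact (h1.mul continuous_const).mul (((h1.sub continuous_const).pow 2).inv₀ h0)
  have hcn : ∀ θ, ‖c θ‖ = 1 := by
    intro θ; simp [hc, deriv_circleMap]
  have key : ∀ z, fderiv ℂ F z v = (2 * Real.pi * Complex.I : ℂ)⁻¹ •
      ∫ θ in (0:ℝ)..(2 * Real.pi), c θ • F (z + (circleMap 0 1 θ) • v) := by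
    intro z
    rw [← aux_line_deriv hF]
    have := Complex.two_pi_I_inv_smul_circleIntegral_sub_sq_inv_smul_of_differentiable
      isOpen_univ (c := 0) (w₀ := 0) (R := 1)
      (f := fun τ : ℂ => F (z + τ • v)) (Set.subset_univ _)
      (aux_line_diff hF z v).differentiableOn (Metric.mem_ball_self one_pos)
    rw [← this, circleIntegral]
    simp only [hc, smul_smul]
  borelize E
  rw [funext key]
  apply Differentiable.const_smul
  intro x₀
  have hcm : Continuous (circleMap 0 1) := continuous_circleMap 0 1
  have hFc := hF.continuous
  obtain ⟨C, hC0, hC⟩ := aux_fderiv_bound hF (‖x₀‖ + 1 + ‖v‖)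
  have := intervalIntegral.hasFDerivAt_integral_of_dominated_of_fderiv_le (𝕜 := ℂ) (μ := volume)
    (a := 0) (b := 2 * Real.pi) (x₀ := x₀) (s := Metric.ball x₀ 1)
    (F := fun z θ => c θ • F (z + (circleMap 0 1 θ) • v))
    (F' := fun z θ => c θ • fderiv ℂ F (z + (circleMap 0 1 θ) • v)) (bound := fun _ => C)
    (Metric.ball_mem_nhds _ one_pos) ?_ ?_ ?_ ?_ ?_ ?_
  · exact this.differentiableAt
  · refine Eventually.of_forall fun z => ?_
    exact Continuous.aestronglyMeasurable (by fun_prop)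
  · exact Continuous.intervalIntegrable (by fun_prop) _ _
  · refine AEStronglyMeasurable.smul hcc.aestronglyMeasurable ?_
    have h1 : Measurable fun θ : ℝ => x₀ + (circleMap 0 1 θ) • v :=
      Continuous.measurable (by fun_prop)
    have : FiniteDimensional ℝ (E →L[ℂ] E) := FiniteDimensional.trans ℝ ℂ _
    have h2 := (measurable_fderiv ℂ F).comp h1
    exact h2.stronglyMeasurable.aestronglyMeasurable
  · refine Eventually.of_forall fun θ _ z hz => ?_
    rw [norm_smul, hcn, one_mul]
    have : ‖z‖ ≤ ‖x₀‖ + 1 := by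
      have := norm_le_norm_add_norm_sub' z x₀
      rw [Metric.mem_ball, dist_eq_norm] at hz
      linarith
    have h2 : ‖z + circleMap 0 1 θ • v‖ ≤ ‖x₀‖ + 1 + ‖v‖ := by
      refine (norm_add_le _ _).trans ?_
      rw [norm_smul]; simp; linarith
    exact hC _ h2
  · simp
  · refine Eventually.of_forall fun θ _ z hz => ?_
    refine HasFDerivAt.const_smul ?_ _
    exact (hasFDerivAt_comp_add_right _).2 (hF _).hasFDerivAt

lemma aux_contDiff {F : E → E} (hF : Differentiable ℂ F) : ContDiff ℂ 2 F := by
  have h1 : ∀ F : E → E, Differentiable ℂ F → ContDiff ℂ 1 F := by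
    intro F hF
    refine contDiff_one_iff_fderiv.2 ⟨hF, ?_⟩
    exact continuous_clm_apply.2 fun v => (aux_fderiv_diff hF v).continuous
  rw [show (2 : WithTop ℕ∞) = 1 + 1 by norm_num, contDiff_succ_iff_fderiv_apply]
  refine ⟨hF, by simp, fun v => h1 _ (aux_fderiv_diff hF v)⟩
end reg
lemma aux_one_dim {a b : ℂ → ℂ} (ha : Differentiable ℂ a) (hb : Differentiable ℂ b)
    (hba : ∀ t, b (a t) = t) (ha0 : a 0 = 0) (ha1 : deriv a 0 = 1) (t : ℂ) : a t = t := by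
  set u := dslope a 0 with hu
  have dsl : ∀ g : ℂ → ℂ, Differentiable ℂ g → Differentiable ℂ (dslope g 0) := fun g hg =>
    differentiableOn_univ.1 ((Complex.differentiableOn_dslope univ_mem).2 hg.differentiableOn)
  have hud : Differentiable ℂ u := dsl a ha
  have hu0 : u 0 = 1 := by rw [hu, dslope_same, ha1]
  have hut : ∀ t, t * u t = a t := by
    intro t
    have := sub_smul_dslope a 0 t
    simpa [ha0] using this
  have hne : ∀ t, u t ≠ 0 := by
    intro t h
    have h1 : a t = 0 := by rw [← hut, h, mul_zero]
    have h2 : t = 0 := by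
      have e1 := hba t
      have e2 := hba 0
      rw [h1] at e1
      rw [ha0] at e2
      rw [← e1, e2]
    rw [h2, hu0] at h
    exact one_ne_zero h
  set g : ℂ → ℂ := fun t => (u t)⁻¹ with hg
  have hgd : Differentiable ℂ g := fun t => (hud t).inv (hne t)
  have hg0 : g 0 = 1 := by simp [hg, hu0]
  set k := dslope g 0 with hk
  have hkd : Differentiable ℂ k := dsl g hgd
  have hkt : ∀ t, t * k t = g t - 1 := by
    intro t
    have := sub_smul_dslope g 0 t
    simpa [hg0] using this
  obtain ⟨R, hR⟩ := (isCompact_closedBall (0:ℂ) 1).exists_bound_of_continuousOn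
    hb.continuous.continuousOn
  obtain ⟨M, hM⟩ := (isCompact_closedBall (0:ℂ) (max R 1)).exists_bound_of_continuousOn
    hkd.continuous.continuousOn
  have hbd : ∀ t, ‖k t‖ ≤ max M 2 := by
    intro t
    by_cases h : ‖t‖ ≤ max R 1
    · exact (hM t (by simpa using h)).trans (le_max_left _ _)
    · push Not at h
      have h1 : R < ‖t‖ := (le_max_left _ _).trans_lt h
      have h2 : 1 < ‖t‖ := (le_max_right _ _).trans_lt h
      have h3 : 1 < ‖a t‖ := by
        by_contra h3
        push Not at h3
        have := hR (a t) (by simpa using h3)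
        rw [hba] at this
        linarith
      refine le_trans ?_ (le_max_right _ _)
      have h4 : ‖g t‖ ≤ ‖t‖ := by
        have : t = g t * a t := by
          rw [← hut, hg]; field_simp [hne t]
        have h5 : ‖t‖ = ‖g t‖ * ‖a t‖ := by rw [← norm_mul, ← this]
        nlinarith [norm_nonneg (g t)]
      have h6 : ‖t‖ * ‖k t‖ ≤ ‖t‖ + 1 := by
        rw [← norm_mul, hkt]
        refine (norm_sub_le _ _).trans ?_
        simpa using h4
      nlinarith [norm_nonneg (k t)]
  have hconst : ∀ t, k t = k 0 := fun t => hkd.apply_eq_apply_of_bounded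
    (isBounded_iff_forall_norm_le.2 ⟨_, by rintro _ ⟨t, rfl⟩; exact hbd t⟩) t 0
  have hk0 : k 0 = 0 := by
    by_contra h
    have h1 := hkt (-(k 0)⁻¹)
    rw [hconst (-(k 0)⁻¹)] at h1
    have h2 : g (-(k 0)⁻¹) = 0 := by
      have : -(k 0)⁻¹ * k 0 = -1 := by field_simp
      rw [this] at h1
      linear_combination -h1
    exact inv_ne_zero (hne _) h2
  have h7 : g t = 1 := by
    have := hkt t
    rw [hconst, hk0, mul_zero] at this
    linear_combination -this
  have h8 : u t = 1 := by simpa [hg] using h7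
  rw [← hut, h8, mul_one]

/-- identity principle along lines -/
lemma aux_ident {E : Type*} [NormedAddCommGroup E] [NormedSpace ℂ E] {f : E → ℂ}
    (hf : Differentiable ℂ f) {p : E} (h : ∀ᶠ z in 𝓝 p, f z = 0) (q : E) : f q = 0 := by
  have h1 : Differentiable ℂ (fun t : ℂ => f (p + t • (q - p))) := by fun_prop
  have h2 : ∀ᶠ t : ℂ in 𝓝 0, f (p + t • (q - p)) = 0 := by
    have : Tendsto (fun t : ℂ => p + t • (q - p)) (𝓝 0) (𝓝 p) := by
      have : Continuous (fun t : ℂ => p + t • (q - p)) := by fun_prop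
      simpa using this.tendsto 0
    exact this.eventually h
  have h3 : AnalyticOnNhd ℂ (fun t : ℂ => f (p + t • (q - p))) Set.univ :=
    fun t _ => h1.analyticAt t
  have := h3.eqOn_zero_of_preconnected_of_eventuallyEq_zero isPreconnected_univ
    (Set.mem_univ 0) h2 (Set.mem_univ 1)
  simpa using this

/-- polarization -/
lemma aux_polar {n : ℕ} {F H : EuclideanSpace ℂ (Fin n) → EuclideanSpace ℂ (Fin n)}
    {B : Set (EuclideanSpace ℂ (Fin n))} (hB : IsOpen B) (hBc : Convex ℝ B)
    (hF : DifferentiableOn ℂ F B) (hH : DifferentiableOn ℂ H B)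
    (hn : ∀ z ∈ B, ‖F z‖ = ‖H z‖) {z ζ : EuclideanSpace ℂ (Fin n)} (hz : z ∈ B) (hζ : ζ ∈ B) :
    inner ℂ (F ζ) (F z) = inner ℂ (H ζ) (H z) := by
  set m := (1/2 : ℝ) • (z + ζ) with hm
  set b := (-Complex.I/2 : ℂ) • (z - ζ) with hb
  have hIb : Complex.I • b = (1/2 : ℝ) • (z - ζ) := by
    rw [hb, smul_smul]
    ext i; simp
    left; ring_nf; simp; norm_num
  have e1 : m + Complex.I • b = z := by rw [hIb, hm]; module
  have e2 : m + (starRingEnd ℂ Complex.I) • b = ζ := by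
    rw [Complex.conj_I, neg_smul, hIb, hm]; module
  set U : Set ℂ := {τ | m + τ • b ∈ B ∧ m + (starRingEnd ℂ τ) • b ∈ B} with hU
  have hUo : IsOpen U := by
    refine (hB.preimage ?_).inter (hB.preimage ?_)
    · fun_prop
    · have := Complex.continuous_conj
      fun_prop
  have hUc : Convex ℝ U := by
    intro s hs t ht x y hx hy hxy
    have hr : (starRingEnd ℂ) (x • s + y • t) = x • (starRingEnd ℂ s) + y • (starRingEnd ℂ t) := by
      simp
    have hl : ∀ s t : ℂ, m + (x • s + y • t) • b = x • (m + s • b) + y • (m + t • b) := by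
      intro s t
      have : m = x • m + y • m := by rw [← add_smul, hxy, one_smul]
      rw [add_smul, smul_assoc, smul_assoc, smul_add, smul_add]
      nth_rewrite 1 [this]
      abel
    refine ⟨?_, ?_⟩
    · rw [hl]; exact hBc hs.1 ht.1 hx hy hxy
    · rw [hr, hl]; exact hBc hs.2 ht.2 hx hy hxy
  have hIU : Complex.I ∈ U := ⟨by rw [e1]; exact hz, by rw [e2]; exact hζ⟩
  have hmB : m ∈ B := by
    have := hBc hz hζ (by norm_num : (0:ℝ) ≤ 1/2) (by norm_num : (0:ℝ) ≤ 1/2) (by norm_num)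
    rwa [hm, smul_add]
  have h0U : (0:ℂ) ∈ U := by
    constructor <;> simpa using hmB
  have hol : ∀ K : EuclideanSpace ℂ (Fin n) → EuclideanSpace ℂ (Fin n), DifferentiableOn ℂ K B →
      AnalyticOnNhd ℂ (fun τ : ℂ => inner ℂ (K (m + (starRingEnd ℂ τ) • b)) (K (m + τ • b))) U := by
    intro K hK
    refine DifferentiableOn.analyticOnNhd ?_ hUo
    intro τ hτ
    refine DifferentiableAt.differentiableWithinAt ?_
    have hd : ∀ τ : ℂ, m + τ • b ∈ B → ∀ i, DifferentiableAt ℂ (fun τ : ℂ => K (m + τ • b) i) τ := by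
      intro τ hτ i
      have h1 : DifferentiableAt ℂ K (m + τ • b) := hK.differentiableAt (hB.mem_nhds hτ)
      have h2 : DifferentiableAt ℂ (fun τ : ℂ => m + τ • b) τ := by fun_prop
      have h3 : DifferentiableAt ℂ (fun τ : ℂ => K (m + τ • b)) τ := 
        DifferentiableAt.comp (f := fun τ : ℂ => m + τ • b) τ h1 h2
      exact (differentiableAt_euclidean.1 h3) i
    simp only [PiLp.inner_apply, RCLike.inner_apply]
    refine DifferentiableAt.fun_sum fun i _ => ?_
    refine (hd τ hτ.1 i).mul ?_
    have := (hd _ hτ.2 i).conj_conj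
    simpa [Function.comp_def] using this
  have hfr : ∃ᶠ τ in 𝓝[≠] (0:ℂ),
      inner ℂ (F (m + (starRingEnd ℂ τ) • b)) (F (m + τ • b)) =
      inner ℂ (H (m + (starRingEnd ℂ τ) • b)) (H (m + τ • b)) := by
    have t1 : Tendsto (fun x : ℝ => (x : ℂ)) (𝓝[≠] 0) (𝓝[≠] 0) := by
      refine tendsto_nhdsWithin_iff.2 ⟨?_, ?_⟩
      · have := Complex.continuous_ofReal.tendsto 0
        exact (by simpa using this : Tendsto (fun x : ℝ => (x : ℂ)) (𝓝 0) (𝓝 0)).mono_left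
          nhdsWithin_le_nhds
      · filter_upwards [self_mem_nhdsWithin] with x hx
        simpa using hx
    refine t1.frequently (Eventually.frequently ?_)
    have t2 := (t1.mono_right nhdsWithin_le_nhds).eventually (hUo.mem_nhds h0U)
    filter_upwards [t2] with x hx
    rw [Complex.conj_ofReal, inner_self_eq_norm_sq_to_K, inner_self_eq_norm_sq_to_K, hn _ hx.1]
  have := (hol F hF).eqOn_of_preconnected_of_frequently_eq (hol H hH) hUc.isPreconnected h0U hfr hIU
  simp only [e1, e2] at this
  exact this
/-- a C² function with vanishing Levi form is locally the real part of a holomorphic function -/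
lemma aux_pluri {n : ℕ} {φ : EuclideanSpace ℂ (Fin n) → ℝ}
    {B : Set (EuclideanSpace ℂ (Fin n))} (hB : IsOpen B) (hBc : Convex ℝ B)
    (hφ : ∀ z ∈ B, ContDiffAt ℝ 2 φ z)
    (hl : ∀ z ∈ B, ∀ v w, fderiv ℝ (fderiv ℝ φ) z (Complex.I • v) w
      = fderiv ℝ (fderiv ℝ φ) z v (Complex.I • w)) {p : EuclideanSpace ℂ (Fin n)} (hp : p ∈ B) :
    ∃ h : EuclideanSpace ℂ (Fin n) → ℂ, DifferentiableOn ℂ h B ∧ ∀ z ∈ B, (h z).re = φ z := by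
  let J : EuclideanSpace ℂ (Fin n) →L[ℝ] EuclideanSpace ℂ (Fin n) :=
    (Complex.I • ContinuousLinearMap.id ℂ (EuclideanSpace ℂ (Fin n))).restrictScalars ℝ
  let L : (EuclideanSpace ℂ (Fin n) →L[ℝ] ℝ) →L[ℝ] (EuclideanSpace ℂ (Fin n) →L[ℝ] ℂ) :=
    LinearMap.toContinuousLinearMap
    { toFun := fun A => Complex.ofRealCLM.comp A - Complex.I • (Complex.ofRealCLM.comp (A.comp J))
      map_add' := by
        intro A A'; ext x; simp; ring
      map_smul' := by
        intro r A; ext x; simp; ring }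
  have hL : ∀ A v, L A v = (A v : ℂ) - Complex.I * (A (Complex.I • v) : ℂ) := by
    intro A v; simp [L, J]
  have hd2 : ∀ z ∈ B, DifferentiableAt ℝ (fderiv ℝ φ) z := fun z hz =>
    ((hφ z hz).fderiv_right (m := 1) (by norm_num)).differentiableAt (by norm_num)
  have hsym : ∀ z ∈ B, ∀ v w, fderiv ℝ (fderiv ℝ φ) z v w = fderiv ℝ (fderiv ℝ φ) z w v :=
    fun z hz v w => ((hφ z hz).isSymmSndFDerivAt (by simp)) v w
  have hdω : ∀ z ∈ B, HasFDerivAt (fun z => L (fderiv ℝ φ z))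
      (L.comp (fderiv ℝ (fderiv ℝ φ) z)) z := fun z hz =>
    L.hasFDerivAt.comp z (hd2 z hz).hasFDerivAt
  obtain ⟨f, hf⟩ := hBc.exists_forall_hasFDerivAt_of_fderiv_symmetric hB
    (ω := fun z => L (fderiv ℝ φ z))
    (fun z hz => (hdω z hz).differentiableAt.differentiableWithinAt) (by
      intro z hz v w
      rw [(hdω z hz).fderiv]
      simp only [ContinuousLinearMap.comp_apply, hL]
      rw [hsym z hz v w, ← hl z hz v w, hsym z hz _ w])
  have hfd : ∀ z ∈ B, DifferentiableAt ℂ f z := by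
    intro z hz
    have hI : ∀ v, L (fderiv ℝ φ z) (Complex.I • v) = Complex.I * L (fderiv ℝ φ z) v := by
      intro v
      rw [hL, hL, smul_smul, Complex.I_mul_I, neg_one_smul, map_neg]
      push_cast
      linear_combination ((fderiv ℝ φ z (Complex.I • v) : ℂ)) * Complex.I_mul_I
    let A : EuclideanSpace ℂ (Fin n) →L[ℂ] ℂ :=
      { toFun := L (fderiv ℝ φ z)
        map_add' := map_add _
        map_smul' := by
          intro c v
          have : c • v = c.re • v + c.im • (Complex.I • v) := by
            ext i; simp
            rw [← mul_assoc, ← add_mul, Complex.re_add_im]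
          rw [this, map_add, map_smul, map_smul, hI]
          simp only [Complex.real_smul, RingHom.id_apply, smul_eq_mul]
          nth_rewrite 3 [← Complex.re_add_im c]
          ring
        cont := (L (fderiv ℝ φ z)).continuous }
    exact (hasFDerivAt_of_restrictScalars ℝ (f' := A) (hf z hz) rfl).differentiableAt
  have hre : ∀ z ∈ B, HasFDerivAt (fun z => (f z).re - φ z)
      (0 : EuclideanSpace ℂ (Fin n) →L[ℝ] ℝ) z := by
    intro z hz
    have h1 := (Complex.reCLM.hasFDerivAt.comp z (hf z hz)).sub
      ((hφ z hz).differentiableAt (by norm_num)).hasFDerivAt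
    have e : Complex.reCLM.comp (L (fderiv ℝ φ z)) - fderiv ℝ φ z = 0 := by
      ext v
      simp [hL]
    rw [e] at h1
    exact h1
  have hconst : ∀ z ∈ B, (f z).re - φ z = (f p).re - φ p := by
    intro z hz
    refine hB.is_const_of_fderiv_eq_zero (𝕜 := ℝ) hBc.isPreconnected
      (f := fun z => (f z).re - φ z) ?_ ?_ hz hp
    · exact fun z hz => (hre z hz).differentiableAt.differentiableWithinAt
    · exact fun z hz => (hre z hz).fderiv
  refine ⟨fun z => f z - (((f p).re - φ p : ℝ) : ℂ), ?_, ?_⟩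
  · intro z hz
    exact ((hfd z hz).sub_const _).differentiableWithinAt
  · intro z hz
    have := hconst z hz
    simp only [Complex.sub_re, Complex.ofReal_re]
    linarith

lemma aux_T {n : ℕ} {F H : EuclideanSpace ℂ (Fin n) → EuclideanSpace ℂ (Fin n)}
    {B : Set (EuclideanSpace ℂ (Fin n))} (hspan : Submodule.span ℂ (H '' B) = ⊤)
    (h : ∀ ζ ∈ B, ∀ z ∈ B, inner ℂ (F ζ) (F z) = inner ℂ (H ζ) (H z)) :
    ∃ T : EuclideanSpace ℂ (Fin n) →ₗ[ℂ] EuclideanSpace ℂ (Fin n), ∀ z ∈ B, H z = T (F z) := by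
  obtain ⟨t, hts, htspan, hli⟩ := exists_linearIndependent ℂ (H '' B)
  let b : Module.Basis t ℂ (EuclideanSpace ℂ (Fin n)) := Module.Basis.mk hli (by
    rw [Subtype.range_coe, htspan, hspan])
  have hpt : ∀ i : t, ∃ ζ ∈ B, H ζ = i := fun i => hts i.2
  choose ζ hζB hζ using hpt
  let U := b.constr ℂ (fun i => F (ζ i))
  refine ⟨LinearMap.adjoint U, fun z hz => ?_⟩
  refine InnerProductSpace.ext_inner_left_basis (𝕜 := ℂ) b fun i => ?_
  rw [LinearMap.adjoint_inner_right]
  have h1 : U (b i) = F (ζ i) := b.constr_basis ℂ _ i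
  have h2 : b i = H (ζ i) := by rw [hζ]; simp [b]
  rw [h1, h2, h _ (hζB i) z hz]

/-- log of the norm is C² -/
lemma aux_log_contDiff {n : ℕ} {F : EuclideanSpace ℂ (Fin n) → EuclideanSpace ℂ (Fin n)}
    (hF : Differentiable ℂ F) {z : EuclideanSpace ℂ (Fin n)} (hz : F z ≠ 0) :
    ContDiffAt ℝ 2 (fun x => Real.log ‖F x‖) z := by
  have h1 : ContDiffAt ℝ 2 F z := ((aux_contDiff hF).restrict_scalars ℝ).contDiffAt
  exact (h1.norm ℂ hz).log (norm_ne_zero_iff.2 hz)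

/-- the imaginary part of the Levi form identity -/
lemma aux_levi_im {n : ℕ} {g₁ g₂ : EuclideanSpace ℂ (Fin n) → ℝ}
    {z : EuclideanSpace ℂ (Fin n)} (h₁ : ContDiffAt ℝ 2 g₁ z) (h₂ : ContDiffAt ℝ 2 g₂ z)
    (v w : EuclideanSpace ℂ (Fin n)) (h : levi g₁ z v w = levi g₂ z v w) :
    fderiv ℝ (fderiv ℝ (fun x => g₁ x - g₂ x)) z (Complex.I • v) w
      = fderiv ℝ (fderiv ℝ (fun x => g₁ x - g₂ x)) z v (Complex.I • w) := by
  have hd : ∀ g : EuclideanSpace ℂ (Fin n) → ℝ, ContDiffAt ℝ 2 g z →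
      DifferentiableAt ℝ (fderiv ℝ g) z := fun g hg =>
    (hg.fderiv_right (m := 1) (by norm_num)).differentiableAt (by norm_num)
  have hev : ∀ g : EuclideanSpace ℂ (Fin n) → ℝ, ContDiffAt ℝ 2 g z →
      ∀ᶠ x in 𝓝 z, DifferentiableAt ℝ g x := fun g hg =>
    (hg.eventually (by simp)).mono fun x hx => hx.differentiableAt (by norm_num)
  have e1 : fderiv ℝ (fun x => g₁ x - g₂ x) =ᶠ[𝓝 z] fun x => fderiv ℝ g₁ x - fderiv ℝ g₂ x := by
    filter_upwards [hev g₁ h₁, hev g₂ h₂] with x hx1 hx2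
    exact fderiv_fun_sub hx1 hx2
  rw [e1.fderiv_eq, fderiv_fun_sub (hd _ h₁) (hd _ h₂)]
  have h3 := congrArg Complex.im h
  simp only [levi, iteratedFDeriv_two_apply] at h3
  simp at h3
  simp only [ContinuousLinearMap.sub_apply]
  linarith

/-- Tangency at the origin forces a linear map to be scalar. -/
lemma aux_scalar {n : ℕ} {F G : EuclideanSpace ℂ (Fin n) → EuclideanSpace ℂ (Fin n)}
    (hF : Differentiable ℂ F) (hG : Differentiable ℂ G) (hF0 : F 0 = 0) (hG0 : G 0 = 0)
    (hDF : fderiv ℂ F 0 = ContinuousLinearMap.id ℂ (EuclideanSpace ℂ (Fin n)))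
    (hDG : fderiv ℂ G 0 = ContinuousLinearMap.id ℂ (EuclideanSpace ℂ (Fin n)))
    (T : EuclideanSpace ℂ (Fin n) →ₗ[ℂ] EuclideanSpace ℂ (Fin n))
    (h : ∀ z i j, G z i * T (F z) j = G z j * T (F z) i) :
    ∃ c : ℂ, ∀ z, T z = c • z := by
  have lim : ∀ K : EuclideanSpace ℂ (Fin n) → EuclideanSpace ℂ (Fin n), Differentiable ℂ K →
      K 0 = 0 → fderiv ℂ K 0 = ContinuousLinearMap.id ℂ (EuclideanSpace ℂ (Fin n)) →
      ∀ z, Tendsto (fun t : ℂ => t⁻¹ • K (t • z)) (𝓝[≠] 0) (𝓝 z) := by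
    intro K hK hK0 hDK z
    have h1 := aux_line_deriv hK 0 z
    have h2 := ((aux_line_diff hK 0 z) 0).hasDerivAt
    rw [h1, hDK] at h2
    have h3 := h2.tendsto_slope_zero
    simpa [hK0] using h3
  have hT : Continuous T := T.continuous_of_finiteDimensional
  have key : ∀ z : EuclideanSpace ℂ (Fin n), ∀ i j, z i * T z j = z j * T z i := by
    intro z i j
    have l1 := lim G hG hG0 hDG z
    have l2 : Tendsto (fun t : ℂ => T (t⁻¹ • F (t • z))) (𝓝[≠] 0) (𝓝 (T z)) :=
      (hT.tendsto z).comp (lim F hF hF0 hDF z)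
    have ci : ∀ i (x : EuclideanSpace ℂ (Fin n)), Tendsto (fun y : EuclideanSpace ℂ (Fin n) => y i)
        (𝓝 x) (𝓝 (x i)) := fun i x => (EuclideanSpace.proj (𝕜 := ℂ) i).continuous.tendsto x
    have a1 := ((ci i _).comp l1).mul ((ci j _).comp l2)
    have a2 := ((ci j _).comp l1).mul ((ci i _).comp l2)
    refine tendsto_nhds_unique_of_eventuallyEq a1 a2 (Eventually.of_forall fun t => ?_)
    have := h (t • z) i j
    simp only [Function.comp_apply, map_smul, PiLp.smul_apply, smul_eq_mul]
    linear_combination (t⁻¹ * t⁻¹) * this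
  obtain ⟨c, hc⟩ := T.exists_eq_smul_id_of_forall_notLinearIndependent (by
    intro v hv
    have hv0 : v ≠ 0 := by simpa using hv.ne_zero 0
    obtain ⟨i, hi⟩ : ∃ i, v i ≠ 0 := by
      by_contra hcon
      push Not at hcon
      exact hv0 (by ext i; simpa using hcon i)
    rw [LinearIndependent.pair_iff] at hv
    have := hv (T v i) (-(v i)) (by
      ext j
      simp only [PiLp.add_apply, PiLp.smul_apply, smul_eq_mul, PiLp.zero_apply]
      linear_combination - key v i j)
    exact hi (by simpa using this.2))
  exact ⟨c, fun z => by rw [hc]; simp⟩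

lemma aux_line_coord {n : ℕ} {Φ : EuclideanSpace ℂ (Fin n) → EuclideanSpace ℂ (Fin n)}
    (hΦ : Differentiable ℂ Φ) (hpar : ∀ z i j, Φ z i * z j = Φ z j * z i) (hΦ0 : Φ 0 = 0)
    (w : EuclideanSpace ℂ (Fin n)) (i : Fin n) (hi : w i ≠ 0) :
    Differentiable ℂ (fun t : ℂ => Φ (t • w) i / w i) ∧
      ∀ t : ℂ, Φ (t • w) = (Φ (t • w) i / w i) • w := by
  constructor
  · have h1 : Differentiable ℂ (fun t : ℂ => Φ (t • w)) := by fun_prop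
    exact ((differentiable_euclidean.1 h1) i).div_const _
  · intro t
    by_cases ht : t = 0
    · simp [ht, hΦ0]
    ext j
    have := hpar (t • w) i j
    simp only [PiLp.smul_apply, smul_eq_mul] at this ⊢
    field_simp
    apply mul_left_cancel₀ ht
    linear_combination -this

/-- An automorphism preserving all lines through the origin, tangent to the identity. -/
lemma aux_lines {n : ℕ} {Φ Ψ : EuclideanSpace ℂ (Fin n) → EuclideanSpace ℂ (Fin n)}
    (hΦ : Differentiable ℂ Φ) (hΨ : Differentiable ℂ Ψ) (hl : ∀ z, Ψ (Φ z) = z)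
    (hΦ0 : Φ 0 = 0) (hΨ0 : Ψ 0 = 0)
    (hDΦ : fderiv ℂ Φ 0 = ContinuousLinearMap.id ℂ (EuclideanSpace ℂ (Fin n)))
    (hpar : ∀ z i j, Φ z i * z j = Φ z j * z i) (hpar' : ∀ z i j, Ψ z i * z j = Ψ z j * z i)
    (w : EuclideanSpace ℂ (Fin n)) : Φ w = w := by
  by_cases hw : w = 0
  · rw [hw, hΦ0]
  obtain ⟨i, hi⟩ : ∃ i, w i ≠ 0 := by
    by_contra hcon
    push Not at hcon
    exact hw (by ext i; simpa using hcon i)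
  obtain ⟨ha, ha'⟩ := aux_line_coord hΦ hpar hΦ0 w i hi
  obtain ⟨hb, hb'⟩ := aux_line_coord hΨ hpar' hΨ0 w i hi
  have h1 := aux_one_dim ha hb (fun t => by
    show Ψ ((Φ (t • w) i / w i) • w) i / w i = t
    rw [← ha' t, hl]
    simp [hi]) (by simp [hΦ0]) (by
    have h2 := ((aux_line_diff hΦ 0 w) 0).hasDerivAt
    rw [aux_line_deriv hΦ 0 w, hDΦ] at h2
    have h3 := ((EuclideanSpace.proj (𝕜 := ℂ) i).hasFDerivAt.comp_hasDerivAt (0:ℂ) h2).div_const (w i)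
    have h4 : HasDerivAt (fun t : ℂ => Φ (t • w) i / w i) (w i / w i) 0 := by
      simpa [Function.comp_def] using h3
    rw [h4.deriv, div_self hi]) 1
  have h2 := ha' 1
  rw [h1] at h2
  simpa using h2

theorem main_theorem_normalized {n : ℕ}
    (F G : EuclideanSpace ℂ (Fin n) → EuclideanSpace ℂ (Fin n))
    (hF : Differentiable ℂ F) (hG : Differentiable ℂ G)
    (Finv Ginv : EuclideanSpace ℂ (Fin n) → EuclideanSpace ℂ (Fin n))
    (hFinv : Differentiable ℂ Finv) (hGinv : Differentiable ℂ Ginv)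
    (hFl : Function.LeftInverse Finv F) (hFr : Function.RightInverse Finv F)
    (hGl : Function.LeftInverse Ginv G) (hGr : Function.RightInverse Ginv G)
    (hF0 : F 0 = 0) (hG0 : G 0 = 0)
    (hDF : fderiv ℂ F 0 = ContinuousLinearMap.id ℂ (EuclideanSpace ℂ (Fin n)))
    (hDG : fderiv ℂ G 0 = ContinuousLinearMap.id ℂ (EuclideanSpace ℂ (Fin n)))
    (hlevi : ∀ z : EuclideanSpace ℂ (Fin n), z ≠ 0 → ∀ v w,
      levi (fun x => Real.log ‖F x‖) z v w
        = levi (fun x => Real.log ‖G x‖) z v w) :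
    F = G := by
  by_cases htriv : ∀ p : EuclideanSpace ℂ (Fin n), p = 0
  · funext z; rw [htriv (F z), htriv (G z)]
  push Not at htriv
  obtain ⟨p, hp⟩ := htriv
  have hFne : ∀ z, z ≠ 0 → F z ≠ 0 := fun z hz h => hz (hFl.injective (h.trans hF0.symm))
  have hGne : ∀ z, z ≠ 0 → G z ≠ 0 := fun z hz h => hz (hGl.injective (h.trans hG0.symm))
  set B := Metric.ball p ‖p‖ with hBdef
  have hBo : IsOpen B := Metric.isOpen_ball
  have hBc : Convex ℝ B := convex_ball _ _
  have hpB : p ∈ B := Metric.mem_ball_self (norm_pos_iff.2 hp)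
  have hB0 : ∀ z ∈ B, z ≠ 0 := by
    rintro z hz rfl
    simp [hBdef] at hz
  obtain ⟨h, hh, hre⟩ := aux_pluri (φ := fun x => Real.log ‖F x‖ - Real.log ‖G x‖) hBo hBc
    (fun z hz => (aux_log_contDiff hF (hFne z (hB0 z hz))).sub
      (aux_log_contDiff hG (hGne z (hB0 z hz))))
    (fun z hz v w => aux_levi_im (aux_log_contDiff hF (hFne z (hB0 z hz)))
      (aux_log_contDiff hG (hGne z (hB0 z hz))) v w (hlevi z (hB0 z hz) v w)) hpB
  set H : EuclideanSpace ℂ (Fin n) → EuclideanSpace ℂ (Fin n) :=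
    fun z => Complex.exp (h z) • G z with hH
  have hHd : DifferentiableOn ℂ H B := hh.cexp.smul hG.differentiableOn
  have hn : ∀ z ∈ B, ‖F z‖ = ‖H z‖ := by
    intro z hz
    have f0 := norm_pos_iff.2 (hFne z (hB0 z hz))
    have g0 := norm_pos_iff.2 (hGne z (hB0 z hz))
    rw [hH]
    simp only
    rw [norm_smul, Complex.norm_exp, hre z hz, Real.exp_sub, Real.exp_log f0, Real.exp_log g0,
      div_mul_cancel₀ _ g0.ne']
  have hspan : Submodule.span ℂ (H '' B) = ⊤ := by
    apply Submodule.eq_top_of_nonempty_interior'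
    have ho : IsOpen (Ginv ⁻¹' B) := hBo.preimage hGinv.continuous
    refine ⟨G p, mem_interior.2 ⟨Ginv ⁻¹' B, ?_, ho, by
      rw [Set.mem_preimage, hGl p]; exact hpB⟩⟩
    intro y hy
    have h1 : H (Ginv y) ∈ Submodule.span ℂ (H '' B) :=
      Submodule.subset_span ⟨_, hy, rfl⟩
    have h2 := Submodule.smul_mem _ (Complex.exp (h (Ginv y)))⁻¹ h1
    rw [hH] at h2
    simp only [smul_smul, hGr y] at h2
    rwa [inv_mul_cancel₀ (Complex.exp_ne_zero _), one_smul] at h2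
  obtain ⟨T, hT⟩ := aux_T hspan
    (fun ζ hζ z hz => aux_polar hBo hBc hF.differentiableOn hHd hn hz hζ)
  have hTc : Differentiable ℂ (fun z => T (F z)) :=
    (LinearMap.toContinuousLinearMap T).differentiable.comp hF
  have hpar1 : ∀ z i j, G z i * T (F z) j = G z j * T (F z) i := by
    intro z i j
    have hGi := differentiable_euclidean.1 hG
    have hTi := differentiable_euclidean.1 hTc
    have := aux_ident (f := fun z => G z i * T (F z) j - G z j * T (F z) i)
      (((hGi i).mul (hTi j)).sub ((hGi j).mul (hTi i))) (p := p) (by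
        filter_upwards [hBo.mem_nhds hpB] with z hz
        rw [← hT z hz]
        simp only [hH, PiLp.smul_apply, smul_eq_mul]
        ring) z
    exact sub_eq_zero.1 this
  obtain ⟨c, hc⟩ := aux_scalar hF hG hF0 hG0 hDF hDG T hpar1
  have hc0 : c ≠ 0 := by
    rintro rfl
    have h1 := hT p hpB
    rw [hc, zero_smul] at h1
    exact smul_ne_zero (Complex.exp_ne_zero _) (hGne p hp) h1
  have hpar : ∀ z i j, F z i * G z j = F z j * G z i := by
    intro z i j
    have := hpar1 z i j
    simp only [hc, PiLp.smul_apply, smul_eq_mul] at this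
    apply mul_left_cancel₀ hc0
    linear_combination -this
  have hGinv0 : Ginv 0 = 0 := by have := hGl 0; rwa [hG0] at this
  have hFinv0 : Finv 0 = 0 := by have := hFl 0; rwa [hF0] at this
  have hDGinv : fderiv ℂ Ginv 0 = ContinuousLinearMap.id ℂ (EuclideanSpace ℂ (Fin n)) := by
    have h1 : HasFDerivAt Ginv (fderiv ℂ Ginv 0) (G 0) := by
      rw [hG0]; exact (hGinv 0).hasFDerivAt
    have h2 := h1.comp 0 (hG 0).hasFDerivAt
    rw [hDG, ContinuousLinearMap.comp_id, hGl.comp_eq_id] at h2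
    exact h2.unique (hasFDerivAt_id 0)
  have hDΦ : fderiv ℂ (fun z => F (Ginv z)) 0
      = ContinuousLinearMap.id ℂ (EuclideanSpace ℂ (Fin n)) := by
    have h1 : HasFDerivAt F (fderiv ℂ F 0) (Ginv 0) := by
      rw [hGinv0]; exact (hF 0).hasFDerivAt
    have h2 := h1.comp 0 (hGinv 0).hasFDerivAt
    rw [hDF, hDGinv, ContinuousLinearMap.comp_id] at h2
    exact h2.fderiv
  have hfin := aux_lines (Φ := fun z => F (Ginv z)) (Ψ := fun z => G (Finv z))
    (hF.comp hGinv) (hG.comp hFinv) (fun z => by simp only [hFl (Ginv z), hGr z])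
    (by simp only [hGinv0, hF0]) (by simp only [hFinv0, hG0]) hDΦ
    (fun z i j => by
      have := hpar (Ginv z) i j
      rwa [hGr z] at this)
    (fun z i j => by
      have := hpar (Finv z) i j
      rw [hFr z] at this
      linear_combination -this)
  funext z
  have := hfin (G z)
  simpa only [hGl z] using this
end
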